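/- Let G = [3, ∞^l, 3] (the case k = m = 1), with l ≥ 1 and n = l + 3, and let p be an odd prime. If it is not the case that p = 7 and l ≥ 4 with l ≡ 1 (mod 3), then G^p = [3, ∞^l, 3]^p is a string C-group. -/

import Mathlib

/- Setup: the reduction mod an odd prime `p` of the `3`-infinity Coxeter group
`[3^k, ∞^l, 3^m]`, acting on `V = (ZMod p)^n` with `n = k + l + m + 1`. -/

namespace Statement10

/-- The Gram matrix of the basic system for `[3^k, ∞^l, 3^m]`, reduced mod `p`:
diagonal entries `1`; the entry for the branch `{i−1, i}` is `−2⁻¹` if the branch is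
labelled `3` (i.e. `1 ≤ i ≤ k` or `k+l+1 ≤ i ≤ n−1`) and `−1` if it is labelled `∞`
(i.e. `k+1 ≤ i ≤ k+l`); all other entries `0`. -/
def gram (p k l m : ℕ) : Matrix (Fin (k + l + m + 1)) (Fin (k + l + m + 1)) (ZMod p) :=
  fun i j =>
    if i = j then 1
    else if (j : ℕ) = (i : ℕ) + 1 then
      (if (j : ℕ) ≤ k ∨ k + l + 1 ≤ (j : ℕ) then -(2⁻¹ : ZMod p) else -1)
    else if (i : ℕ) = (j : ℕ) + 1 then
      (if (i : ℕ) ≤ k ∨ k + l + 1 ≤ (i : ℕ) then -(2⁻¹ : ZMod p) else -1)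
    else 0

/-- The corresponding symmetric bilinear form `x·y` on `V`. -/
def form (p k l m : ℕ) (x y : Fin (k + l + m + 1) → ZMod p) : ZMod p :=
  ∑ i, ∑ j, x i * gram p k l m i j * y j

/-- The general linear group of `V`. -/
abbrev GLV (p k l m : ℕ) := (Module.End (ZMod p) (Fin (k + l + m + 1) → ZMod p))ˣ

/-- `r i` is the generating reflection `r_i : x ↦ x − 2(x·b_i) b_i`. -/
def ReflHyp (p k l m : ℕ) (r : Fin (k + l + m + 1) → GLV p k l m) : Prop :=
  ∀ i x, (r i).1 x =
    x - (2 * form p k l m x (Pi.single i 1)) •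
      (Pi.single i 1 : Fin (k + l + m + 1) → ZMod p)

/-- The intersection property (string C-group condition). -/
def IsStringC (p k l m : ℕ) (r : Fin (k + l + m + 1) → GLV p k l m) : Prop :=
  ∀ I J : Set (Fin (k + l + m + 1)),
    Subgroup.closure (r '' I) ⊓ Subgroup.closure (r '' J) = Subgroup.closure (r '' (I ∩ J))

/-- `O₁(V)` (written `Ô₁(V)` when the form on `V` is degenerate): the subgroup of `O(V)`
generated by all reflections `r_a : x ↦ x − 2((x·a)/(a·a)) a` with `a·a` a nonzero square. -/
def O1 (p k l m : ℕ) : Subgroup (GLV p k l m) :=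
  Subgroup.closure {g | ∃ a : Fin (k + l + m + 1) → ZMod p,
    (∃ t : ZMod p, t ≠ 0 ∧ form p k l m a a = t ^ 2) ∧
    ∀ x, g.1 x = x - (2 * form p k l m x a * (form p k l m a a)⁻¹) • a}

section Reflection

variable {K V : Type*} [Field K] [AddCommGroup V] [Module K V] (B : LinearMap.BilinForm K V)

/-- The linear map `x ↦ x - 2 B(x, a) a`. -/
def reflMap (a : V) : Module.End K V := 1 - (B.flip a).smulRight ((2 : K) • a)

theorem reflMap_apply (a x : V) : reflMap B a x = x - (2 * B x a) • a := by
  simp [reflMap, smul_smul, mul_comm]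

theorem reflMap_mul_self {a : V} (h : B a a = 1) : reflMap B a * reflMap B a = 1 := by
  ext x
  simp only [Module.End.mul_apply, reflMap_apply, map_sub, map_smul, h, Module.End.one_apply]
  module

open Classical in
/-- The reflection in a vector of norm `1`; the identity for all other vectors. -/
noncomputable def refl (a : V) : (Module.End K V)ˣ :=
  if h : B a a = 1 then ⟨reflMap B a, reflMap B a, reflMap_mul_self B h, reflMap_mul_self B h⟩
  else 1

variable {B}

theorem refl_smul {a : V} (h : B a a = 1) (x : V) :
    refl B a • x = x - (2 * B x a) • a := by
  rw [refl, dif_pos h, Units.smul_def, Module.End.smul_def]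
  exact reflMap_apply B a x

theorem units_ext {g h : (Module.End K V)ˣ} (H : ∀ x : V, g • x = h • x) : g = h :=
  Units.ext (LinearMap.ext H)

theorem refl_mul_self {a : V} (h : B a a = 1) : refl B a * refl B a = 1 := by
  rw [refl, dif_pos h]
  exact Units.ext (reflMap_mul_self B h)

theorem refl_inv {a : V} (h : B a a = 1) : (refl B a)⁻¹ = refl B a :=
  inv_eq_of_mul_eq_one_left (refl_mul_self h)

theorem refl_neg (a : V) : refl B (-a) = refl B a := by
  by_cases h : B a a = 1
  · have h' : B (-a) (-a) = 1 := by simpa using h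
    refine units_ext fun x => ?_
    rw [refl_smul h, refl_smul h']
    simp
  · have h' : ¬ B (-a) (-a) = 1 := by simpa using h
    rw [refl, refl, dif_neg h, dif_neg h']

variable (B) in
/-- The group of invertible isometries of `B`. -/
def isom : Subgroup (Module.End K V)ˣ where
  carrier := {g | ∀ x y, B (g • x) (g • y) = B x y}
  one_mem' := by simp
  mul_mem' {g h} hg hh x y := by
    rw [mul_smul, mul_smul, hg, hh]
  inv_mem' {g} hg x y := by
    rw [← hg, smul_inv_smul, smul_inv_smul]

theorem isom_apply {g : (Module.End K V)ˣ} (hg : g ∈ isom B) (x y : V) :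
    B (g • x) (g • y) = B x y := hg x y

theorem bsymm (hB : B.IsSymm) (x y : V) : B x y = B y x := by
  simpa using hB.eq x y

theorem refl_mem_isom (hB : B.IsSymm) {a : V} (h : B a a = 1) : refl B a ∈ isom B := by
  intro x y
  have := bsymm hB a y
  simp only [refl_smul h, map_sub, map_smul, LinearMap.sub_apply,
    LinearMap.smul_apply, h, smul_eq_mul, ← this]
  ring

theorem refl_conj {g : (Module.End K V)ˣ} (hg : g ∈ isom B) {a : V} (h : B a a = 1) :
    refl B (g • a) = g * refl B a * g⁻¹ := by
  have h' : B (g • a) (g • a) = 1 := by rw [isom_apply hg, h]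
  refine units_ext fun x => ?_
  have : B x (g • a) = B (g⁻¹ • x) a := by rw [← isom_apply hg (g⁻¹ • x), smul_inv_smul]
  have e : (g * refl B a * g⁻¹) • x = g • refl B a • g⁻¹ • x := by rw [mul_smul, mul_smul]
  rw [refl_smul h', this, e, refl_smul h, smul_sub, smul_inv_smul, smul_comm g]

variable (B) in
/-- The group generated by the reflections in the norm `1` vectors of a set. -/
def reflGroup (S : Set V) : Subgroup (Module.End K V)ˣ :=
  Subgroup.closure (refl B '' {a ∈ S | B a a = 1})

theorem refl_mem_reflGroup {S : Set V} {a : V} (ha : a ∈ S) (h : B a a = 1) :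
    refl B a ∈ reflGroup B S :=
  Subgroup.subset_closure ⟨a, ⟨ha, h⟩, rfl⟩

theorem reflGroup_mono {S T : Set V} (h : S ⊆ T) : reflGroup B S ≤ reflGroup B T :=
  Subgroup.closure_mono (Set.image_mono fun _ hx => ⟨h hx.1, hx.2⟩)

theorem reflGroup_le {S : Set V} {G : Subgroup (Module.End K V)ˣ}
    (h : ∀ a ∈ S, B a a = 1 → refl B a ∈ G) : reflGroup B S ≤ G := by
  rw [reflGroup, Subgroup.closure_le]
  rintro _ ⟨a, ha, rfl⟩
  exact h a ha.1 ha.2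

theorem reflGroup_le_isom (hB : B.IsSymm) (S : Set V) : reflGroup B S ≤ isom B :=
  reflGroup_le fun _ _ h => refl_mem_isom hB h

theorem reflGroup_sub_mem {S : Set V} {M : Submodule K V} (hS : S ⊆ M)
    {g : (Module.End K V)ˣ} (hg : g ∈ reflGroup B S) (x : V) : g • x - x ∈ M := by
  revert x
  refine Subgroup.closure_induction (p := fun g _ => ∀ x : V, g • x - x ∈ M) ?_ ?_ ?_ ?_ hg
  · rintro _ ⟨a, ⟨ha, h⟩, rfl⟩ x
    rw [refl_smul h, sub_sub_cancel_left]
    exact M.neg_mem (M.smul_mem _ (hS ha))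
  · simp
  · intro g h _ _ h1 h2 x
    have := M.add_mem (h1 (h • x)) (h2 x)
    rwa [sub_add_sub_cancel, ← mul_smul] at this
  · intro g _ h x
    have := M.neg_mem (h (g⁻¹ • x))
    rwa [smul_inv_smul, neg_sub] at this

theorem reflGroup_smul_mem {S : Set V} {M : Submodule K V} (hS : S ⊆ M)
    {g : (Module.End K V)ˣ} (hg : g ∈ reflGroup B S) {x : V} (hx : x ∈ M) : g • x ∈ M := by
  have := M.add_mem (reflGroup_sub_mem hS hg x) hx
  rwa [sub_add_cancel] at this

theorem reflGroup_fix {S : Set V} {g : (Module.End K V)ˣ} (hg : g ∈ reflGroup B S) {x : V}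
    (hx : ∀ a ∈ S, B x a = 0) : g • x = x := by
  refine Subgroup.closure_induction (p := fun g _ => g • x = x) ?_ ?_ ?_ ?_ hg
  · rintro _ ⟨a, ⟨ha, h⟩, rfl⟩
    rw [refl_smul h, hx a ha]
    simp
  · simp
  · intro g h _ _ h1 h2
    rw [mul_smul, h2, h1]
  · intro g _ h
    rw [inv_smul_eq_iff, h]

/-- Two vectors agree up to sign and the action of `G`. -/
def SignEquiv (G : Subgroup (Module.End K V)ˣ) (u v : V) : Prop :=
  ∃ g ∈ G, g • u = v ∨ g • u = -v

namespace SignEquiv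

variable {G H : Subgroup (Module.End K V)ˣ} {u v w : V}

theorem rfl' : SignEquiv G u u := ⟨1, G.one_mem, by simp⟩

theorem symm (h : SignEquiv G u v) : SignEquiv G v u := by
  obtain ⟨g, hg, h | h⟩ := h
  · exact ⟨g⁻¹, G.inv_mem hg, Or.inl (by rw [← h, inv_smul_smul])⟩
  · exact ⟨g⁻¹, G.inv_mem hg, Or.inr (by rw [inv_smul_eq_iff, smul_neg, h, neg_neg])⟩

theorem trans (h : SignEquiv G u v) (h' : SignEquiv G v w) : SignEquiv G u w := by
  obtain ⟨g, hg, h⟩ := h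
  obtain ⟨k, hk, h'⟩ := h'
  refine ⟨k * g, G.mul_mem hk hg, ?_⟩
  rcases h with h | h <;> rcases h' with h' | h' <;> simp [mul_smul, h, h']

theorem of_refl {a : V} (ha : B a a = 1) (hG : refl B a ∈ G)
    (h : u - (2 * B u a) • a = v ∨ u - (2 * B u a) • a = -v) : SignEquiv G u v :=
  ⟨_, hG, by rwa [refl_smul ha]⟩

theorem refl_mem (h : SignEquiv G u v) (hG : G ≤ isom B) (hv : B v v = 1) (hr : refl B v ∈ G) :
    refl B u ∈ G := by
  obtain ⟨g, hg, h⟩ := h.symm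
  have hu : refl B u = refl B (g • v) := by
    rcases h with h | h
    · rw [h]
    · rw [h, refl_neg]
  rw [hu, refl_conj (hG hg) hv]
  exact G.mul_mem (G.mul_mem hg hr) (G.inv_mem hg)

end SignEquiv

end Reflection

section Rank3

variable {K V : Type*} [Field K] [AddCommGroup V] [Module K V] {B : LinearMap.BilinForm K V}

variable (B) in
/-- A hyperbolic pair `e, f` together with a vector `c` of norm `η` orthogonal to it. -/
structure HypTriple (η : K) (c e f : V) : Prop where
  cc : B c c = η
  ee : B e e = 0
  ff : B f f = 0
  ef : B e f = -1
  fe : B f e = -1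
  ce : B c e = 0
  ec : B e c = 0
  cf : B c f = 0
  fc : B f c = 0

theorem HypTriple.norm_add_smul {η : K} {c e f : V} (h : HypTriple B η c e f) (t : K) :
    B (c + t • e) (c + t • e) = η := by
  simp [h.cc, h.ee, h.ce, h.ec]

end Rank3

section Prime

variable {p : ℕ} [Fact p.Prime] {V : Type*} [AddCommGroup V] [Module (ZMod p) V]
  {B : LinearMap.BilinForm (ZMod p) V} {G : Subgroup (Module.End (ZMod p) V)ˣ}

theorem two_ne_zero_zmod (hp : p ≠ 2) : (2 : ZMod p) ≠ 0 := by
  intro h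
  have h2 : ((2 : ℕ) : ZMod p) = 0 := by exact_mod_cast h
  rw [ZMod.natCast_eq_zero_iff] at h2
  exact hp ((Nat.prime_dvd_prime_iff_eq Fact.out Nat.prime_two).1 h2)

theorem three_ne_zero_zmod (hp : p ≠ 3) : (3 : ZMod p) ≠ 0 := by
  intro h
  have h3 : ((3 : ℕ) : ZMod p) = 0 := by exact_mod_cast h
  rw [ZMod.natCast_eq_zero_iff] at h3
  exact hp ((Nat.prime_dvd_prime_iff_eq Fact.out Nat.prime_three).1 h3)

theorem signEquiv_line (hp : p ≠ 2) {a e : V} {s : ZMod p} (haa : B a a = 1) (hee : B e e = 0)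
    (hae : B a e = 0) (hea : B e a = 0) (hs : s ≠ 0) (h0 : refl B a ∈ G)
    (h1 : refl B (a + s • e) ∈ G) (t : ZMod p) : SignEquiv G (a + t • e) a := by
  have hn : B (a + s • e) (a + s • e) = 1 := by simp [haa, hee, hae, hea]
  have key : ∀ k : ℕ, SignEquiv G (a + (2 * s * k) • e) a := by
    intro k
    induction k with
    | zero => simpa using SignEquiv.rfl'
    | succ k ih =>
      refine SignEquiv.trans (SignEquiv.symm ?_) ih
      refine ⟨refl B (a + s • e) * refl B a, G.mul_mem h1 h0, Or.inl ?_⟩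
      rw [mul_smul, refl_smul haa, refl_smul hn]
      simp only [map_add, map_smul, map_sub, LinearMap.add_apply, LinearMap.sub_apply,
        LinearMap.smul_apply, smul_eq_mul, haa, hee, hae, hea]
      push_cast
      module
  have h2 := two_ne_zero_zmod hp
  have := key (t / (2 * s)).val
  rw [ZMod.natCast_zmod_val] at this
  rwa [mul_div_cancel₀ _ (mul_ne_zero h2 hs)] at this

/-- In the plane-plus-line spanned by a triple, all norm `1` vectors are equivalent to `c`. -/
theorem signEquiv_triple (hp : p ≠ 2) {c e f : V} (h : HypTriple B 1 c e f)
    (h0 : refl B c ∈ G) (he : refl B (c - e) ∈ G) (hf : refl B (c - f) ∈ G)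
    (hG : G ≤ isom B) {γ α β : ZMod p}
    (hn : B (γ • c + α • e + β • f) (γ • c + α • e + β • f) = 1) :
    SignEquiv G (γ • c + α • e + β • f) c := by
  have h2 := two_ne_zero_zmod hp
  have hE : ∀ t : ZMod p, SignEquiv G (c + t • e) c :=
    signEquiv_line (B := B) hp h.cc h.ee h.ce h.ec (s := -1) (by simp) h0
      (by simpa [sub_eq_add_neg] using he)
  have hF : ∀ t : ZMod p, SignEquiv G (c + t • f) c :=
    signEquiv_line (B := B) hp h.cc h.ff h.cf h.fc (s := -1) (by simp) h0
      (by simpa [sub_eq_add_neg] using hf)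
  simp only [map_add, map_smul, LinearMap.add_apply,
        LinearMap.smul_apply, smul_eq_mul, h.cc, h.ce, h.ec, h.cf, h.fc, h.ee, h.ff, h.ef, h.fe] at hn
  by_cases hβ : β = 0
  · subst hβ
    have hγ : (γ - 1) * (γ + 1) = 0 := by linear_combination hn
    rcases mul_eq_zero.1 hγ with hγ | hγ
    · rw [show γ = 1 by linear_combination hγ]
      simpa using hE α
    · rw [show γ = -1 by linear_combination hγ]
      refine SignEquiv.trans ⟨1, G.one_mem, Or.inr ?_⟩ (hE (-α))
      rw [one_smul]
      module
  · obtain ⟨t, ht⟩ : ∃ t : ZMod p, 2 * β * t = 1 + γ :=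
      ⟨(1 + γ) / (2 * β), mul_div_cancel₀ _ (mul_ne_zero h2 hβ)⟩
    have hr : refl B (c + t • e) ∈ G := (hE t).refl_mem hG h.cc h0
    refine SignEquiv.trans (SignEquiv.of_refl (h.norm_add_smul t) hr (Or.inl ?_)) (hF β)
    simp only [map_add, map_smul, LinearMap.add_apply, LinearMap.smul_apply, smul_eq_mul,
      h.cc, h.ce, h.ec, h.fc, h.ee, h.fe]
    have hα : α - 2 * (γ - β * t) * t = 0 := by
      have : β * (α - 2 * (γ - β * t) * t) * 2 = 0 := by
        linear_combination (-1) * hn + ht * (2*β * t +1- γ)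
      simpa [hβ, h2] using this
    have e1 : γ - 2 * (γ - β * t) = 1 := by linear_combination ht
    calc _ = (γ - 2 * (γ - β * t)) • c + (α - 2 * (γ - β * t) * t) • e + β • f := by module
      _ = _ := by rw [hα, e1]; module

end Prime

section Extension

variable {p : ℕ} [Fact p.Prime] {V : Type*} [AddCommGroup V] [Module (ZMod p) V]
  {B : LinearMap.BilinForm (ZMod p) V} {G H : Subgroup (Module.End (ZMod p) V)ˣ}

theorem HypTriple.refl_mem (hp : p ≠ 2) {c e f : V} (h : HypTriple B 1 c e f)
    (h0 : refl B c ∈ G) (he : refl B (c - e) ∈ G) (hf : refl B (c - f) ∈ G)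
    (hG : G ≤ isom B) {γ α β : ZMod p} (hn : γ ^ 2 - 2 * α * β = 1) :
    B (γ • c + α • e + β • f) (γ • c + α • e + β • f) = 1 ∧
      refl B (γ • c + α • e + β • f) ∈ G := by
  have hn' : B (γ • c + α • e + β • f) (γ • c + α • e + β • f) = 1 := by
    simp only [map_add, map_smul, LinearMap.add_apply,
        LinearMap.smul_apply, smul_eq_mul, h.cc, h.ce, h.ec, h.cf, h.fc, h.ee, h.ff, h.ef, h.fe]
    linear_combination hn
  exact ⟨hn', (signEquiv_triple hp h h0 he hf hG hn').refl_mem hG h.cc h0⟩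

/-- A norm `1` vector `c'` orthogonal to a triple is equivalent to all its translates along `e`,
as soon as this holds for one nontrivial translate. -/
theorem signEquiv_translate (hp : p ≠ 2) (hp3 : p ≠ 3) {c e f c' : V} (h : HypTriple B 1 c e f)
    (h0 : refl B c ∈ G) (he : refl B (c - e) ∈ G) (hf : refl B (c - f) ∈ G)
    (hG : G ≤ isom B) (hc' : B c' c' = 1) (hce : B c' e = 0) (hec : B e c' = 0)
    (hcf : B c' f = 0) (hlink : SignEquiv G (c' + e) c) (t : ZMod p) :
    SignEquiv G (c' + t • e) c := by
  have h2 := two_ne_zero_zmod hp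
  have h4 : (4 : ZMod p) ≠ 0 := by
    rw [show (4 : ZMod p) = 2 * 2 by norm_num]; exact mul_ne_zero h2 h2
  obtain ⟨n1, r1⟩ := h.refl_mem hp h0 he hf hG (γ := 0) (α := 1) (β := -(1 / 2))
    (by field_simp; norm_num)
  obtain ⟨n2, r2⟩ := h.refl_mem hp h0 he hf hG (γ := 0) (α := 2) (β := -(1 / 4))
    (by field_simp; norm_num)
  have hlink4 : SignEquiv G (c' + (4 : ZMod p) • e) c := by
    refine SignEquiv.trans (SignEquiv.symm ?_) hlink
    refine ⟨_, G.mul_mem r2 r1, Or.inl ?_⟩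
    rw [mul_smul, refl_smul n1, refl_smul n2]
    simp only [map_add, map_smul, map_sub, LinearMap.add_apply, LinearMap.sub_apply,
      LinearMap.smul_apply, smul_eq_mul, h.cc, h.ce, h.ec, h.cf, h.fc, h.ee, h.ff, h.ef, h.fe,
      hce, hcf]
    match_scalars <;> field_simp <;> ring
  have ha : B (c' + e) (c' + e) = 1 := by simp [hc', hce, hec, h.ee]
  have := signEquiv_line (G := G) (a := c' + e) (e := e) (s := 3) hp ha h.ee
    (by simp [hce, h.ee]) (by simp [hec, h.ee]) (three_ne_zero_zmod hp3)
    (hlink.refl_mem hG h.cc h0)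
    (by
      have := hlink4.refl_mem hG h.cc h0
      convert this using 2
      module) (t - 1)
  refine SignEquiv.trans ?_ hlink
  convert this using 1
  module

theorem signEquiv_add_isotropic (hp : p ≠ 2) {c e f c' : V} (h : HypTriple B 1 c e f)
    (h0 : refl B c ∈ G) (he : refl B (c - e) ∈ G) (hf : refl B (c - f) ∈ G)
    (hG : G ≤ isom B) (htr : ∀ t : ZMod p, SignEquiv G (c' + t • e) c)
    (hHG : H ≤ G) (hHe : ∀ g ∈ H, g • e = e) {w : V} (hw : SignEquiv H w c')
    (hwc : B w c = 0) (hwe : B w e = 0) (hwf : B w f = 0)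
    {γ α β : ZMod p} (hn : γ ^ 2 = 2 * α * β) :
    SignEquiv G (w + (γ • c + α • e + β • f)) c := by
  have h2 := two_ne_zero_zmod hp
  have hline : ∀ t : ZMod p, SignEquiv G (w + t • e) c := by
    intro t
    obtain ⟨g, hg, hgw | hgw⟩ := hw
    · refine SignEquiv.trans ⟨g, hHG hg, Or.inl ?_⟩ (htr t)
      rw [smul_add, smul_comm, hHe g hg, hgw]
    · refine SignEquiv.trans ⟨g, hHG hg, Or.inr ?_⟩ (htr (-t))
      rw [smul_add, smul_comm, hHe g hg, hgw]
      module
  by_cases hα : α = 0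
  · subst hα
    have hγ : γ = 0 := by simpa using hn
    subst hγ
    obtain ⟨n1, r1⟩ := h.refl_mem hp h0 he hf hG (γ := 0) (α := 1) (β := -(1 / 2))
      (by field_simp; norm_num)
    refine SignEquiv.trans (SignEquiv.of_refl n1 r1 (Or.inl ?_)) (hline (2 * β))
    simp only [map_add, map_smul, LinearMap.add_apply,
      LinearMap.smul_apply, smul_eq_mul, h.cc, h.ce, h.ec, h.cf, h.fc, h.ee, h.ff, h.ef, h.fe,
      hwe, hwf, hwc]
    match_scalars <;> field_simp <;> ring
  · obtain ⟨t, ht⟩ : ∃ t : ZMod p, 2 * α * t = γ :=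
      ⟨γ / (2 * α), mul_div_cancel₀ _ (mul_ne_zero h2 hα)⟩
    obtain ⟨n1, r1⟩ := h.refl_mem hp h0 he hf hG (γ := 1) (α := 0) (β := t) (by ring)
    refine SignEquiv.trans (SignEquiv.of_refl n1 r1 (Or.inl ?_)) (hline α)
    simp only [map_add, map_smul, LinearMap.add_apply,
      LinearMap.smul_apply, smul_eq_mul, h.cc, h.ce, h.ec, h.cf, h.fc, h.ee, h.ff, h.ef, h.fe,
      hwe, hwf, hwc]
    have hβ : β = 2 * α * t ^ 2 := by
      have : (2 * α) * (β - 2 * α * t ^ 2) = 0 := by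
        linear_combination (-1) * hn - (γ + 2 * α * t) * ht
      have := (mul_eq_zero.1 this).resolve_left (mul_ne_zero h2 hα)
      linear_combination this
    rw [hβ, ← ht]
    module

/-- A vector of norm `1` in the sum of a triple and an orthogonal space `W` can be moved so that
its `W`-component has norm `1`. -/
theorem signEquiv_extend (hp : p ≠ 2) {c e f c' : V} (h : HypTriple B 1 c e f)
    (h0 : refl B c ∈ G) (he : refl B (c - e) ∈ G) (hf : refl B (c - f) ∈ G)
    (hG : G ≤ isom B) (htr : ∀ t : ZMod p, SignEquiv G (c' + t • e) c)
    (hHG : H ≤ G) (hHe : ∀ g ∈ H, g • e = e) {W : Submodule (ZMod p) V}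
    (hW : ∀ w ∈ W, B w w = 1 → SignEquiv H w c')
    (hWc : ∀ w ∈ W, B w c = 0) (hWe : ∀ w ∈ W, B w e = 0) (hWf : ∀ w ∈ W, B w f = 0)
    (hB : B.IsSymm) {γ α β : ZMod p} {w w' : V} (hw : w ∈ W) (hw' : w' ∈ W) (hn' : B w' w' = 1)
    (hsq : IsSquare (1 - B w w + B w w' ^ 2))
    (hn : B (γ • c + α • e + β • f + w) (γ • c + α • e + β • f + w) = 1) :
    SignEquiv G (γ • c + α • e + β • f + w) c := by
  have h2 := two_ne_zero_zmod hp
  have hcW : ∀ w ∈ W, B c w = 0 := fun w hw => by rw [bsymm hB, hWc w hw]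
  have heW : ∀ w ∈ W, B e w = 0 := fun w hw => by rw [bsymm hB, hWe w hw]
  have hfW : ∀ w ∈ W, B f w = 0 := fun w hw => by rw [bsymm hB, hWf w hw]
  have hZ : ∀ w ∈ W, B w w = 1 → ∀ γ α β : ZMod p, γ ^ 2 = 2 * α * β →
      SignEquiv G (w + (γ • c + α • e + β • f)) c := fun w hw hn γ α β h1 =>
    signEquiv_add_isotropic hp h h0 he hf hG htr hHG hHe (hW w hw hn) (hWc w hw) (hWe w hw)
      (hWf w hw) h1
  have hnorm : ∀ (x y z : ZMod p), ∀ w ∈ W, B (x • c + y • e + z • f + w)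
      (x • c + y • e + z • f + w) = x ^ 2 - 2 * y * z + B w w := by
    intro x y z w hw
    simp only [map_add, map_smul, LinearMap.add_apply,
      LinearMap.smul_apply, smul_eq_mul, h.cc, h.ce, h.ec, h.cf, h.fc, h.ee, h.ff, h.ef, h.fe,
      hWc w hw, hWe w hw, hWf w hw, hcW w hw, heW w hw, hfW w hw]
    ring
  rw [hnorm _ _ _ _ hw] at hn
  by_cases hu : γ = 0 ∧ α = 0 ∧ β = 0
  · obtain ⟨rfl, rfl, rfl⟩ := hu
    have := hZ w hw (by linear_combination hn) 0 0 0 (by ring)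
    rwa [add_comm] at this
  obtain ⟨x, y, z, hxyz, hd⟩ : ∃ x y z : ZMod p, x ^ 2 = 2 * y * z ∧
      γ * x - α * z - β * y ≠ 0 := by
    by_cases hα : α = 0
    · by_cases hβ : β = 0
      · refine ⟨1, 1, 1 / 2, by field_simp, ?_⟩
        subst hα hβ
        simpa using hu
      · exact ⟨0, 1, 0, by ring, by simpa using hβ⟩
    · exact ⟨0, 0, 1, by ring, by simpa using hα⟩
  set d := γ * x - α * z - β * y with hdd
  obtain ⟨s, hs⟩ := hsq
  set k := B w w' with hk
  obtain ⟨τ, hτ⟩ : ∃ τ, 2 * τ = s - k := ⟨(s - k) / 2, mul_div_cancel₀ _ h2⟩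
  obtain ⟨q, hq⟩ : ∃ q, d * q = τ := ⟨τ / d, mul_div_cancel₀ _ hd⟩
  have hZ' := hZ w' hw' hn' (q * x) (q * y) (q * z) (by linear_combination q ^ 2 * hxyz)
  have hna : B (w' + ((q * x) • c + (q * y) • e + (q * z) • f))
      (w' + ((q * x) • c + (q * y) • e + (q * z) • f)) = 1 := by
    rw [add_comm w', hnorm _ _ _ _ hw', hn']
    linear_combination q ^ 2 * hxyz
  have hra := hZ'.refl_mem hG h.cc h0
  have hκ : B (γ • c + α • e + β • f + w) (w' + ((q * x) • c + (q * y) • e + (q * z) • f))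
      = k + τ := by
    simp only [map_add, map_smul, LinearMap.add_apply,
      LinearMap.smul_apply, smul_eq_mul, h.cc, h.ce, h.ec, h.cf, h.fc, h.ee, h.ff, h.ef, h.fe,
      hWc w hw, hWe w hw, hWf w hw, hcW w' hw', heW w' hw', hfW w' hw', ← hk]
    linear_combination hq + q * hdd
  have hw1 : w - (2 * (k + τ)) • w' ∈ W := W.sub_mem hw (W.smul_mem _ hw')
  have hww : B w' w = k := by rw [bsymm hB]
  have hn1 : B (w - (2 * (k + τ)) • w') (w - (2 * (k + τ)) • w') = 1 := by
    simp only [map_sub, map_smul, LinearMap.sub_apply, LinearMap.smul_apply, smul_eq_mul, hww,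
      ← hk, hn']
    linear_combination (-1) * hs + (2 * τ + k + s) * hτ
  refine SignEquiv.trans (SignEquiv.of_refl hna hra (Or.inl ?_))
    (hZ _ hw1 hn1 (γ - 2 * (k + τ) * (q * x)) (α - 2 * (k + τ) * (q * y))
      (β - 2 * (k + τ) * (q * z)) ?_)
  · rw [hκ]
    module
  · linear_combination hn + hs - (2 * τ + k + s) * hτ - 4 * (k + τ) * hq +
      4 * (k + τ) ^ 2 * q ^ 2 * hxyz + 4 * (k + τ) * q * hdd

end Extension

section Chain

variable {K V : Type*} [Field K] [AddCommGroup V] [Module K V] {B : LinearMap.BilinForm K V}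

theorem SignEquiv.neg_left {G : Subgroup (Module.End K V)ˣ} {u v : V} (h : SignEquiv G u v) :
    SignEquiv G (-u) v := by
  obtain ⟨g, hg, h | h⟩ := h
  · exact ⟨g, hg, Or.inr (by rw [smul_neg, h])⟩
  · exact ⟨g, hg, Or.inl (by rw [smul_neg, h, neg_neg])⟩

variable (B) in
/-- The first `m` vectors of `c` have norm `1`, consecutive ones have product `-1`, and all other
pairs are orthogonal. -/
structure IsChain (m : ℕ) (c : ℕ → V) : Prop where
  norm : ∀ i, i < m → B (c i) (c i) = 1
  adj : ∀ i, i + 1 < m → B (c i) (c (i + 1)) = -1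
  adj' : ∀ i, i + 1 < m → B (c (i + 1)) (c i) = -1
  far : ∀ i j, i + 2 ≤ j → j < m → B (c i) (c j) = 0
  far' : ∀ i j, i + 2 ≤ j → j < m → B (c j) (c i) = 0

/-- The span of the first `m` vectors of a sequence. -/
def chainSpan (c : ℕ → V) (m : ℕ) : Submodule K V := Submodule.span K (c '' Set.Iio m)

variable (B) in
/-- The group generated by the reflections in the first `m` vectors of a sequence. -/
def chainGroup (c : ℕ → V) (m : ℕ) : Subgroup (Module.End K V)ˣ :=
  Subgroup.closure ((fun i => refl B (c i)) '' Set.Iio m)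

theorem mem_chainSpan {c : ℕ → V} {m i : ℕ} (h : i < m) : c i ∈ chainSpan (K := K) c m :=
  Submodule.subset_span ⟨i, h, rfl⟩

theorem refl_mem_chainGroup {c : ℕ → V} {m i : ℕ} (h : i < m) :
    refl B (c i) ∈ chainGroup B c m :=
  Subgroup.subset_closure ⟨i, h, rfl⟩

theorem chainGroup_le {c : ℕ → V} {m : ℕ} {G : Subgroup (Module.End K V)ˣ}
    (h : ∀ i < m, refl B (c i) ∈ G) : chainGroup B c m ≤ G := by
  rw [chainGroup, Subgroup.closure_le]
  rintro _ ⟨i, hi, rfl⟩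
  exact h i hi

theorem IsChain.chainGroup_le_reflGroup {c : ℕ → V} {m : ℕ} (h : IsChain B m c) :
    chainGroup B c m ≤ reflGroup B (chainSpan (K := K) c m : Set V) :=
  chainGroup_le fun i hi => refl_mem_reflGroup (mem_chainSpan hi) (h.norm i hi)

/-- The triple at the beginning of a chain. -/
theorem IsChain.hypTriple {c : ℕ → V} {m : ℕ} (h : IsChain B m c) (hm : 3 ≤ m) :
    HypTriple B 1 (c 1) (c 0 + c 1) (c 1 + c 2) := by
  have n0 := h.norm 0 (by lia)
  have n1 := h.norm 1 (by lia)
  have n2 := h.norm 2 (by lia)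
  have a0 := h.adj 0 (by lia)
  have a1 := h.adj 1 (by lia)
  have a0' := h.adj' 0 (by lia)
  have a1' := h.adj' 1 (by lia)
  have f := h.far 0 2 (by lia) (by lia)
  have f' := h.far' 0 2 (by lia) (by lia)
  simp only [zero_add, Nat.reduceAdd] at a0 a1 a0' a1'
  constructor <;> simp [f, f', a0', a1', a0, a1, n0, n1, n2]

/-- The chain of length `m` orthogonal to the first three vectors of a chain of
length `m + 3`. -/
def nextChain (c : ℕ → V) (i : ℕ) : V := if i = 0 then c 3 - c 0 - c 1 else c (3 + i)

theorem IsChain.next {c : ℕ → V} {m : ℕ} (h : IsChain B (m + 3) c) :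
    IsChain B m (nextChain c) := by
  rcases Nat.eq_zero_or_pos m with rfl | hm
  · constructor <;> intros <;> lia
  have n0 := h.norm 0 (by lia)
  have n1 := h.norm 1 (by lia)
  have n3 := h.norm 3 (by lia)
  have a0 : B (c 0) (c 1) = -1 := h.adj 0 (by lia)
  have a0' : B (c 1) (c 0) = -1 := h.adj' 0 (by lia)
  have f0 := h.far 0 3 (by lia) (by lia)
  have f1 := h.far 1 3 (by lia) (by lia)
  have f0' := h.far' 0 3 (by lia) (by lia)
  have f1' := h.far' 1 3 (by lia) (by lia)
  constructor
  · rintro (_ | i) hi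
    · simp [nextChain, n0, n1, n3, a0, a0', f0, f1, f0', f1']
    · simpa [nextChain] using h.norm _ (by lia)
  · rintro (_ | i) hi
    · have e1 : B (c 3) (c 4) = -1 := h.adj 3 (by lia)
      simp [nextChain, e1, h.far 0 4 (by lia) (by lia), h.far 1 4 (by lia) (by lia)]
    · simpa [nextChain, ← add_assoc] using h.adj (3 + (i + 1)) (by lia)
  · rintro (_ | i) hi
    · have e1 : B (c 4) (c 3) = -1 := h.adj' 3 (by lia)
      simp [nextChain, e1, h.far' 0 4 (by lia) (by lia), h.far' 1 4 (by lia) (by lia)]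
    · simpa [nextChain, ← add_assoc] using h.adj' (3 + (i + 1)) (by lia)
  · rintro (_ | i) j hij hj
    · have : j ≠ 0 := by lia
      simp [nextChain, this, h.far 0 (3 + j) (by lia) (by lia),
        h.far 1 (3 + j) (by lia) (by lia), h.far 3 (3 + j) (by lia) (by lia)]
    · have : j ≠ 0 := by lia
      simpa [nextChain, this] using h.far (3 + (i + 1)) (3 + j) (by lia) (by lia)
  · rintro (_ | i) j hij hj
    · have : j ≠ 0 := by lia
      simp [nextChain, this, h.far' 0 (3 + j) (by lia) (by lia),
        h.far' 1 (3 + j) (by lia) (by lia), h.far' 3 (3 + j) (by lia) (by lia)]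
    · have : j ≠ 0 := by lia
      simpa [nextChain, this] using h.far' (3 + (i + 1)) (3 + j) (by lia) (by lia)

theorem IsChain.next_orthogonal {c : ℕ → V} {m : ℕ} (h : IsChain B (m + 3) c) {i j : ℕ}
    (hi : i < m) (hj : j < 3) : B (nextChain c i) (c j) = 0 := by
  rcases i with _ | i
  · have a0 : B (c 0) (c 1) = -1 := h.adj 0 (by lia)
    have a0' : B (c 1) (c 0) = -1 := h.adj' 0 (by lia)
    have a1 : B (c 1) (c 2) = -1 := h.adj 1 (by lia)
    have a2 : B (c 3) (c 2) = -1 := h.adj' 2 (by lia)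
    interval_cases j
    · simp [nextChain, h.norm 0 (by lia), a0', h.far' 0 3 (by lia) (by lia)]
    · simp [nextChain, h.norm 1 (by lia), a0, h.far' 1 3 (by lia) (by lia)]
    · simp [nextChain, a1, a2, h.far 0 2 (by lia) (by lia)]
  · simpa [nextChain] using h.far' j (3 + (i + 1)) (by lia) (by lia)

theorem IsChain.next_span_orthogonal {c : ℕ → V} {m : ℕ} (h : IsChain B (m + 3) c) {w : V}
    (hw : w ∈ chainSpan (K := K) (nextChain c) m) {j : ℕ} (hj : j < 3) : B w (c j) = 0 := by
  have : chainSpan (nextChain c) m ≤ LinearMap.ker (B.flip (c j)) := by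
    rw [chainSpan, Submodule.span_le]
    rintro _ ⟨i, hi, rfl⟩
    simpa using h.next_orthogonal hi hj
  simpa using this hw

theorem chainSpan_next_le (c : ℕ → V) (m : ℕ) :
    chainSpan (K := K) (nextChain c) m ≤ chainSpan c (m + 3) := by
  rw [chainSpan, Submodule.span_le]
  rintro _ ⟨i, hi, rfl⟩
  have hi : i < m := hi
  rcases i with _ | i
  · exact Submodule.sub_mem _ (Submodule.sub_mem _ (mem_chainSpan (by lia))
      (mem_chainSpan (by lia))) (mem_chainSpan (by lia))
  · simpa [nextChain] using mem_chainSpan (by lia)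

theorem exists_eq_add_of_mem_chainSpan {c : ℕ → V} {m : ℕ} {w : V}
    (hw : w ∈ chainSpan (K := K) c (m + 3)) :
    ∃ γ α β : K, ∃ w' ∈ chainSpan (K := K) (nextChain c) m,
      w = γ • c 1 + α • (c 0 + c 1) + β • (c 1 + c 2) + w' := by
  induction hw using Submodule.span_induction with
  | mem x hx =>
    obtain ⟨i, hi, rfl⟩ := hx
    have hi : i < m + 3 := hi
    rcases i with _ | _ | _ | _ | i
    · exact ⟨-1, 1, 0, 0, Submodule.zero_mem _, by module⟩
    · exact ⟨1, 0, 0, 0, Submodule.zero_mem _, by simp⟩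
    · exact ⟨-1, 0, 1, 0, Submodule.zero_mem _, by simp⟩
    · refine ⟨0, 1, 0, nextChain c 0, mem_chainSpan (by lia), ?_⟩
      simp only [nextChain, if_true, zero_add]
      module
    · refine ⟨0, 0, 0, nextChain c (i + 1), mem_chainSpan (by lia), ?_⟩
      simp [nextChain, show 3 + (i + 1) = i + 1 + 1 + 1 + 1 by lia]
  | zero => exact ⟨0, 0, 0, 0, Submodule.zero_mem _, by simp⟩
  | add x y _ _ hx hy =>
    obtain ⟨γ, α, β, w, hw, rfl⟩ := hx
    obtain ⟨γ', α', β', w', hw', rfl⟩ := hy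
    exact ⟨γ + γ', α + α', β + β', w + w', Submodule.add_mem _ hw hw', by module⟩
  | smul a x _ hx =>
    obtain ⟨γ, α, β, w, hw, rfl⟩ := hx
    exact ⟨a * γ, a * α, a * β, a • w, Submodule.smul_mem _ _ hw, by module⟩

theorem chainSpan_zero (c : ℕ → V) : chainSpan (K := K) c 0 = ⊥ := by
  simp [chainSpan]

theorem chainSpan_succ (c : ℕ → V) (m : ℕ) :
    chainSpan (K := K) c (m + 1) = chainSpan c m ⊔ Submodule.span K {c m} := by
  rw [chainSpan, chainSpan, ← Submodule.span_union]
  congr 1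
  ext x
  simp only [Set.mem_image, Set.mem_Iio, Set.mem_union, Set.mem_singleton_iff, Order.lt_add_one_iff,
    le_iff_lt_or_eq]
  constructor
  · rintro ⟨i, hi | rfl, rfl⟩
    · exact Or.inl ⟨i, hi, rfl⟩
    · exact Or.inr rfl
  · rintro (⟨i, hi, rfl⟩ | rfl)
    · exact ⟨i, Or.inl hi, rfl⟩
    · exact ⟨m, Or.inr rfl, rfl⟩

theorem mem_chainSpan_one {c : ℕ → V} {w : V} (hw : w ∈ chainSpan (K := K) c 1) :
    ∃ x : K, w = x • c 0 := by
  rw [chainSpan_succ, chainSpan_zero, bot_sup_eq, Submodule.mem_span_singleton] at hw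
  obtain ⟨x, rfl⟩ := hw
  exact ⟨x, rfl⟩

theorem mem_chainSpan_two {c : ℕ → V} {w : V} (hw : w ∈ chainSpan (K := K) c 2) :
    ∃ x y : K, w = x • c 0 + y • c 1 := by
  rw [show 2 = 1 + 1 from rfl, chainSpan_succ, Submodule.mem_sup] at hw
  obtain ⟨u, hu, v, hv, rfl⟩ := hw
  obtain ⟨x, rfl⟩ := mem_chainSpan_one hu
  obtain ⟨y, rfl⟩ := Submodule.mem_span_singleton.1 hv
  exact ⟨x, y, rfl⟩

end Chain

section TheoremA

variable {p : ℕ} [Fact p.Prime] {V : Type*} [AddCommGroup V] [Module (ZMod p) V]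
  {B : LinearMap.BilinForm (ZMod p) V} {G : Subgroup (Module.End (ZMod p) V)ˣ}

theorem exists_norm_one (hp : p ≠ 2) {γ α β : ZMod p} (h0 : γ ≠ 0 ∨ α ≠ 0 ∨ β ≠ 0) (k : ZMod p) :
    ∃ x y z : ZMod p, x ^ 2 - 2 * y * z = 1 ∧ γ * x - α * z - β * y = k := by
  have h2 := two_ne_zero_zmod hp
  by_cases hβ : β = 0
  · by_cases hα : α = 0
    · subst hα hβ
      have hγ : γ ≠ 0 := by simpa using h0
      exact ⟨k / γ, 1, ((k / γ) ^ 2 - 1) / 2, by field_simp; ring, by field_simp; ring⟩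
    · subst hβ
      exact ⟨1, 0, (γ - k) / α, by ring, by field_simp; ring⟩
  · exact ⟨1, (γ - k) / β, 0, by ring, by field_simp; ring⟩

theorem IsChain.exists_isSquare (hp : p ≠ 2) (hB : B.IsSymm) (m : ℕ) :
    ∀ c : ℕ → V, IsChain B (m + 1) c → ∀ w ∈ chainSpan (K := ZMod p) c (m + 1),
      ∃ w' ∈ chainSpan (K := ZMod p) c (m + 1), B w' w' = 1 ∧
        IsSquare (1 - B w w + B w w' ^ 2) := by
  have h2 := two_ne_zero_zmod hp
  induction m using Nat.strong_induction_on with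
  | _ m ih =>
    intro c h w hw
    rcases m with _ | _ | m
    · obtain ⟨x, rfl⟩ := mem_chainSpan_one hw
      have n0 := h.norm 0 (by lia)
      refine ⟨c 0, mem_chainSpan (by lia), n0, 1, ?_⟩
      simp [n0]
      ring
    · obtain ⟨x, y, rfl⟩ := mem_chainSpan_two hw
      have n0 := h.norm 0 (by lia)
      have n1 := h.norm 1 (by lia)
      have a0 : B (c 0) (c 1) = -1 := h.adj 0 (by lia)
      have a0' : B (c 1) (c 0) = -1 := h.adj' 0 (by lia)
      refine ⟨c 0, mem_chainSpan (by lia), n0, 1, ?_⟩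
      simp [n0, n1, a0, a0']
      ring
    · obtain ⟨γ, α, β, w2, hw2, rfl⟩ := exists_eq_add_of_mem_chainSpan hw
      have T := h.hypTriple (by lia)
      have hc0 := mem_chainSpan (K := ZMod p) (c := c) (show 0 < m + 1 + 1 + 1 by lia)
      have hc1 := mem_chainSpan (K := ZMod p) (c := c) (show 1 < m + 1 + 1 + 1 by lia)
      have hc2 := mem_chainSpan (K := ZMod p) (c := c) (show 2 < m + 1 + 1 + 1 by lia)
      have o1 := h.next_span_orthogonal hw2 (show 1 < 3 by lia)
      have oe : B w2 (c 0 + c 1) = 0 := by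
        rw [map_add, o1, h.next_span_orthogonal hw2 (show 0 < 3 by lia), add_zero]
      have of : B w2 (c 1 + c 2) = 0 := by
        rw [map_add, o1, h.next_span_orthogonal hw2 (show 2 < 3 by lia), add_zero]
      have o1' := o1
      have oe' := oe
      have of' := of
      rw [bsymm hB] at o1' oe' of'
      set e := c 0 + c 1
      set f := c 1 + c 2
      have he : e ∈ chainSpan (K := ZMod p) c (m + 3) := Submodule.add_mem _ hc0 hc1
      have hf : f ∈ chainSpan (K := ZMod p) c (m + 3) := Submodule.add_mem _ hc1 hc2
      by_cases hu : γ ≠ 0 ∨ α ≠ 0 ∨ β ≠ 0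
      · set ν := B (γ • c 1 + α • e + β • f + w2) (γ • c 1 + α • e + β • f + w2) with hν
        obtain ⟨x, y, z, hn, hk⟩ := exists_norm_one hp hu (ν / 2)
        refine ⟨x • c 1 + y • e + z • f, Submodule.add_mem _ (Submodule.add_mem _
          (Submodule.smul_mem _ _ hc1) (Submodule.smul_mem _ _ he)) (Submodule.smul_mem _ _ hf),
          ?_, 1 - ν / 2, ?_⟩
        · simp only [map_add, map_smul, LinearMap.add_apply, LinearMap.smul_apply, smul_eq_mul,
            T.cc, T.ce, T.ec, T.cf, T.fc, T.ee, T.ff, T.ef, T.fe]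
          linear_combination hn
        · have : B (γ • c 1 + α • e + β • f + w2) (x • c 1 + y • e + z • f) = ν / 2 := by
            simp only [map_add, map_smul, LinearMap.add_apply, LinearMap.smul_apply, smul_eq_mul,
              T.cc, T.ce, T.ec, T.cf, T.fc, T.ee, T.ff, T.ef, T.fe, o1, oe, of]
            linear_combination hk
          rw [this]
          field_simp
          ring
      · push Not at hu
        obtain ⟨rfl, rfl, rfl⟩ := hu
        rcases m with _ | m
        · rw [chainSpan_zero, Submodule.mem_bot] at hw2
          subst hw2
          exact ⟨c 1, hc1, T.cc, 1, by simp⟩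
        · obtain ⟨w', hw', hn, hs⟩ := ih m (by lia) (nextChain c) h.next w2 hw2
          refine ⟨w', chainSpan_next_le c _ hw', hn, ?_⟩
          simpa using hs

theorem IsChain.signEquiv_succ (hp : p ≠ 2) {m i : ℕ} {c : ℕ → V} (h : IsChain B m c)
    (hi : i + 1 < m) : SignEquiv (chainGroup B c m) (c (i + 1)) (c i) := by
  have n0 := h.norm i (by lia)
  have n1 := h.norm (i + 1) (by lia)
  have a0 := h.adj i (by lia)
  have a0' := h.adj' i (by lia)
  have := signEquiv_line (B := B) (G := chainGroup B c m) hp (a := c i) (e := c i + c (i + 1))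
    (s := -1) n0 (by simp [n0, n1, a0, a0']) (by simp [n0, a0]) (by simp [n0, a0']) (by simp)
    (refl_mem_chainGroup (by lia)) (by
      rw [show c i + (-1 : ZMod p) • (c i + c (i + 1)) = -c (i + 1) by module, refl_neg]
      exact refl_mem_chainGroup hi) (-1)
  rw [show c i + (-1 : ZMod p) • (c i + c (i + 1)) = -c (i + 1) by module] at this
  simpa using this.neg_left

theorem IsChain.chainGroup_le_isom {m : ℕ} {c : ℕ → V} (hB : B.IsSymm) (h : IsChain B m c) :
    chainGroup B c m ≤ isom B :=
  chainGroup_le fun i hi => refl_mem_isom hB (h.norm i hi)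

/-- All norm `1` vectors in the span of a chain are equivalent up to sign. -/
theorem IsChain.signEquiv (hp : p ≠ 2) (hp3 : p ≠ 3) (hB : B.IsSymm) (m : ℕ) :
    ∀ c : ℕ → V, IsChain B (m + 1) c → ∀ v ∈ chainSpan (K := ZMod p) c (m + 1), B v v = 1 →
      SignEquiv (chainGroup B c (m + 1)) v (c 0) := by
  induction m using Nat.strong_induction_on with
  | _ m ih =>
    intro c h v hv hn
    rcases m with _ | _ | m
    · obtain ⟨x, rfl⟩ := mem_chainSpan_one hv
      simp only [map_smul, LinearMap.smul_apply, smul_eq_mul, h.norm 0 (by lia), mul_one] at hn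
      refine ⟨1, Subgroup.one_mem _, ?_⟩
      rcases mul_self_eq_one_iff.1 hn with rfl | rfl <;> simp
    · obtain ⟨x, y, rfl⟩ := mem_chainSpan_two hv
      have n0 := h.norm 0 (by lia)
      have n1 := h.norm 1 (by lia)
      have a0 : B (c 0) (c 1) = -1 := h.adj 0 (by lia)
      have a0' : B (c 1) (c 0) = -1 := h.adj' 0 (by lia)
      simp only [map_add, map_smul, LinearMap.add_apply, LinearMap.smul_apply, smul_eq_mul, n0, n1,
        a0, a0'] at hn
      have hl := signEquiv_line (B := B) (G := chainGroup B c (0 + 1 + 1)) hp (a := c 0)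
        (e := c 0 + c 1)
        (s := -1) n0 (by simp [n0, n1, a0, a0']) (by simp [n0, a0]) (by simp [n0, a0']) (by simp)
        (refl_mem_chainGroup (by lia)) (by
          rw [show c 0 + (-1 : ZMod p) • (c 0 + c 1) = -c 1 by module, refl_neg]
          exact refl_mem_chainGroup (by lia))
      have : (x - y - 1) * (x - y + 1) = 0 := by linear_combination hn
      rcases mul_eq_zero.1 this with h1 | h1
      · convert hl y using 1
        rw [show x = y + 1 by linear_combination h1]
        module
      · convert (hl (-y)).neg_left using 1
        rw [show x = y - 1 by linear_combination h1]
        module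
    · have T := h.hypTriple (by lia)
      have hG := h.chainGroup_le_isom hB
      have r1 : refl B (c 1) ∈ chainGroup B c (m + 3) := refl_mem_chainGroup (by lia)
      have re : refl B (c 1 - (c 0 + c 1)) ∈ chainGroup B c (m + 3) := by
        rw [show c 1 - (c 0 + c 1) = - c 0 by module, refl_neg]
        exact refl_mem_chainGroup (by lia)
      have rf : refl B (c 1 - (c 1 + c 2)) ∈ chainGroup B c (m + 3) := by
        rw [show c 1 - (c 1 + c 2) = - c 2 by module, refl_neg]
        exact refl_mem_chainGroup (by lia)
      refine SignEquiv.trans ?_ (h.signEquiv_succ hp (i := 0) (by lia))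
      obtain ⟨γ, α, β, w, hw, rfl⟩ := exists_eq_add_of_mem_chainSpan hv
      rcases m with _ | m
      · rw [chainSpan_zero, Submodule.mem_bot] at hw
        subst hw
        rw [add_zero] at hn ⊢
        exact signEquiv_triple hp T r1 re rf hG hn
      · have ho : ∀ w ∈ chainSpan (K := ZMod p) (nextChain c) (m + 1), B w (c 1) = 0 ∧
            B w (c 0 + c 1) = 0 ∧ B w (c 1 + c 2) = 0 := by
          intro w hw
          simp [h.next_span_orthogonal hw (show 1 < 3 by lia),
            h.next_span_orthogonal hw (show 0 < 3 by lia),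
            h.next_span_orthogonal hw (show 2 < 3 by lia)]
        have hc0 := mem_chainSpan (K := ZMod p) (c := nextChain c) (show 0 < m + 1 by lia)
        have hlink : SignEquiv (chainGroup B c (m + 1 + 3)) (nextChain c 0 + (c 0 + c 1))
            (c 1) := by
          rw [show nextChain c 0 + (c 0 + c 1) = c 3 by simp [nextChain]]
          exact (h.signEquiv_succ hp (i := 2) (by lia)).trans
            (h.signEquiv_succ hp (i := 1) (by lia))
        have htr := signEquiv_translate hp hp3 T r1 re rf hG (h.next.norm 0 (by lia))
          (ho _ hc0).2.1 (by rw [bsymm hB]; exact (ho _ hc0).2.1) (ho _ hc0).2.2 hlink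
        have hle : chainGroup B (nextChain c) (m + 1) ≤ chainGroup B c (m + 1 + 3) := by
          refine chainGroup_le fun i hi => ?_
          rcases i with _ | i
          · have := htr 0
            rw [zero_smul, add_zero] at this
            exact this.refl_mem hG T.cc r1
          · simpa [nextChain] using refl_mem_chainGroup (B := B) (c := c)
              (show 3 + (i + 1) < m + 1 + 3 by lia)
        have hfix : ∀ g ∈ chainGroup B (nextChain c) (m + 1), g • (c 0 + c 1) = c 0 + c 1 := by
          intro g hg
          refine reflGroup_fix (h.next.chainGroup_le_reflGroup hg) fun a ha => ?_
          rw [bsymm hB]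
          exact (ho a ha).2.1
        obtain ⟨w', hw', hn', hsq⟩ := IsChain.exists_isSquare hp hB m (nextChain c) h.next w hw
        exact signEquiv_extend hp T r1 re rf hG htr hle hfix
          (ih m (by lia) (nextChain c) h.next) (fun w hw => (ho w hw).1) (fun w hw => (ho w hw).2.1)
          (fun w hw => (ho w hw).2.2) hB hw hw' hn' hsq hn

theorem IsChain.chainGroup_eq (hp : p ≠ 2) (hp3 : p ≠ 3) (hB : B.IsSymm) {m : ℕ} {c : ℕ → V}
    (h : IsChain B m c) :
    chainGroup B c m = reflGroup B (chainSpan (K := ZMod p) c m : Set V) := by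
  refine le_antisymm h.chainGroup_le_reflGroup (reflGroup_le fun a ha hn => ?_)
  rcases m with _ | m
  · rw [chainSpan_zero] at ha
    have : a = 0 := ha
    simp [this] at hn
  · exact (IsChain.signEquiv hp hp3 hB m c h a ha hn).refl_mem (h.chainGroup_le_isom hB)
      (h.norm 0 (by lia)) (refl_mem_chainGroup (by lia))

end TheoremA

section Transitivity

variable {p : ℕ} [Fact p.Prime] {V : Type*} [AddCommGroup V] [Module (ZMod p) V]
  {B : LinearMap.BilinForm (ZMod p) V}

theorem exists_reflGroup_smul_eq_of_sub (hp : p ≠ 2) (hB : B.IsSymm) {X : Submodule (ZMod p) V}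
    {u v : V} (hu : u ∈ X) (hv : v ∈ X) (huv : B u u = B v v) {s : ZMod p} (hs : s ≠ 0)
    (h : B (u - v) (u - v) = s ^ 2) : ∃ g ∈ reflGroup B (X : Set V), g • u = v := by
  have h2 := two_ne_zero_zmod hp
  have hn : B (s⁻¹ • (u - v)) (s⁻¹ • (u - v)) = 1 := by
    rw [map_smul, map_smul, LinearMap.smul_apply, h]
    simp only [smul_eq_mul]
    field_simp
  refine ⟨_, refl_mem_reflGroup (X.smul_mem _ (X.sub_mem hu hv)) hn, ?_⟩
  have hk : 2 * B u (u - v) = s ^ 2 := by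
    have := bsymm hB u v
    simp only [map_sub, LinearMap.sub_apply] at h ⊢
    linear_combination h + huv - this
  rw [refl_smul hn, map_smul, smul_smul, smul_eq_mul]
  rw [show 2 * (s⁻¹ * B u (u - v)) * s⁻¹ = 1 by
    field_simp
    linear_combination hk]
  module

theorem HypTriple.exists_smul_add (hp : p ≠ 2) (hp3 : p ≠ 3) (hB : B.IsSymm)
    {X : Submodule (ZMod p) V} {η : ZMod p} {c e f : V} (h : HypTriple B η c e f) (hη : η ≠ 0)
    (hc : c ∈ X) (he : e ∈ X) (hf : f ∈ X) (t : ZMod p) :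
    ∃ g ∈ reflGroup B (X : Set V), g • (c + t • e) = c := by
  have h2 := two_ne_zero_zmod hp
  have h3 := three_ne_zero_zmod hp3
  have h4 : (4 : ZMod p) ≠ 0 := by
    rw [show (4 : ZMod p) = 2 * 2 by norm_num]; exact mul_ne_zero h2 h2
  by_cases ht : t = 0
  · exact ⟨1, Subgroup.one_mem _, by simp [ht]⟩
  set b : ZMod p := -3 / t with hb
  have hb0 : b ≠ 0 := div_ne_zero (neg_ne_zero.2 h3) ht
  have hbt : b * t = -3 := div_mul_cancel₀ _ ht
  obtain ⟨a, ha⟩ : ∃ a, 2 * b * a = η⁻¹ - 1 :=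
    ⟨(η⁻¹ - 1) / (2 * b), mul_div_cancel₀ _ (mul_ne_zero h2 hb0)⟩
  have hηi : η⁻¹ * η = 1 := inv_mul_cancel₀ hη
  set x := η⁻¹ • c + a • e + b • f with hx
  have hxX : x ∈ X := X.add_mem (X.add_mem (X.smul_mem _ hc) (X.smul_mem _ he)) (X.smul_mem _ hf)
  have hxx : B x x = 1 := by
    simp only [hx, map_add, map_smul, LinearMap.add_apply, LinearMap.smul_apply, smul_eq_mul,
      h.cc, h.ce, h.ec, h.cf, h.fc, h.ee, h.ff, h.ef, h.fe]
    linear_combination η⁻¹ * hηi - ha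
  have hux : B (c + t • e) x = 4 := by
    simp only [hx, map_add, map_smul, LinearMap.add_apply, LinearMap.smul_apply, smul_eq_mul,
      h.cc, h.ce, h.ec, h.cf, h.ee, h.ef]
    linear_combination hηi - hbt
  have hr := refl_mem_reflGroup hxX hxx
  have hu' := refl_smul hxx (c + t • e)
  rw [hux] at hu'
  have hu'X : c + t • e - (2 * 4 : ZMod p) • x ∈ X :=
    X.sub_mem (X.add_mem hc (X.smul_mem _ he)) (X.smul_mem _ hxX)
  obtain ⟨g, hg, hgu⟩ := exists_reflGroup_smul_eq_of_sub hp hB hu'X hc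
    (by
      have := isom_apply (refl_mem_isom hB hxx) (c + t • e) (c + t • e)
      rw [hu', h.norm_add_smul] at this
      rw [this, h.cc]) h4
    (by
      rw [show c + t • e - (2 * 4 : ZMod p) • x - c = t • e - (8 : ZMod p) • x by module]
      have hex : B e x = -b := by
        simp only [hx, map_add, map_smul, smul_eq_mul, h.ec, h.ee, h.ef]
        ring
      have hxe : B x e = -b := by rw [bsymm hB, hex]
      simp only [map_sub, map_smul, LinearMap.sub_apply, LinearMap.smul_apply, smul_eq_mul, hex,
        hxe, hxx, h.ee]
      linear_combination 16 * hbt)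
  refine ⟨g * refl B x, Subgroup.mul_mem _ hg hr, ?_⟩
  rw [mul_smul, hu', hgu]

theorem HypTriple.exists_smul_eq (hp : p ≠ 2) (hp3 : p ≠ 3) (hB : B.IsSymm)
    {X : Submodule (ZMod p) V} {η : ZMod p} {c e f : V} (h : HypTriple B η c e f) (hη : η ≠ 0)
    (hc : c ∈ X) (he : e ∈ X) (hf : f ∈ X) {u : V} (hu : u ∈ X) (hn : B u u = η) :
    ∃ g ∈ reflGroup B (X : Set V), g • u = c := by
  have h2 := two_ne_zero_zmod hp
  have main : ∀ u ∈ X, B u u = η → B u e ≠ 0 → ∃ g ∈ reflGroup B (X : Set V), g • u = c := by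
    intro u hu hn hue
    obtain ⟨t, ht⟩ : ∃ t, 2 * B u e * t = 2 * η - 2 * B u c - 1 :=
      ⟨_, mul_div_cancel₀ _ (mul_ne_zero h2 hue)⟩
    obtain ⟨g, hg, hgu⟩ := exists_reflGroup_smul_eq_of_sub hp hB hu
      (X.add_mem hc (X.smul_mem t he)) (by rw [hn, h.norm_add_smul]) one_ne_zero (by
        have s1 := bsymm hB c u
        have s2 := bsymm hB e u
        simp only [map_sub, map_add, map_smul, LinearMap.sub_apply, LinearMap.add_apply,
          LinearMap.smul_apply, smul_eq_mul, hn, h.cc, h.ce, h.ec, h.ee, s1, s2]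
        linear_combination -ht)
    obtain ⟨g', hg', hgu'⟩ := h.exists_smul_add hp hp3 hB hη hc he hf t
    exact ⟨g' * g, Subgroup.mul_mem _ hg' hg, by rw [mul_smul, hgu, hgu']⟩
  by_cases hue : B u e = 0
  · obtain ⟨b, hb0, hb⟩ : ∃ b : ZMod p, b ≠ 0 ∧ 1 + b * B u f ≠ 0 := by
      by_cases hφ : 1 + B u f = 0
      · refine ⟨-1, by simp, ?_⟩
        rw [show 1 + -1 * B u f = 2 by linear_combination -hφ]
        exact h2
      · exact ⟨1, one_ne_zero, by rwa [one_mul]⟩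
    obtain ⟨a, ha⟩ : ∃ a, 2 * b * a = η⁻¹ + 2 * η⁻¹ * b * B u f - 1 :=
      ⟨_, mul_div_cancel₀ _ (mul_ne_zero h2 hb0)⟩
    have hηi : η⁻¹ * η = 1 := inv_mul_cancel₀ hη
    have heu : B e u = 0 := by rw [bsymm hB, hue]
    have hfu : B f u = B u f := bsymm hB _ _
    set x := η⁻¹ • u + a • e + b • f with hx
    have hxX : x ∈ X :=
      X.add_mem (X.add_mem (X.smul_mem _ hu) (X.smul_mem _ he)) (X.smul_mem _ hf)
    have hxx : B x x = 1 := by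
      simp only [hx, map_add, map_smul, LinearMap.add_apply, LinearMap.smul_apply, smul_eq_mul,
        hn, hue, heu, hfu, h.ee, h.ff, h.ef, h.fe]
      linear_combination η⁻¹ * hηi - ha
    have hux : B u x = 1 + b * B u f := by
      simp only [hx, map_add, map_smul, smul_eq_mul, hn, hue]
      linear_combination hηi
    have hxe : B x e = -b := by
      simp only [hx, map_add, map_smul, LinearMap.add_apply, LinearMap.smul_apply, smul_eq_mul,
        hue, h.ee, h.fe]
      ring
    have hr := refl_mem_reflGroup hxX hxx
    obtain ⟨g, hg, hgu⟩ := main (refl B x • u) (reflGroup_smul_mem subset_rfl hr hu)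
      (by rw [isom_apply (refl_mem_isom hB hxx), hn]) (by
        rw [refl_smul hxx, map_sub, map_smul, LinearMap.sub_apply, LinearMap.smul_apply, hue, hxe,
          hux, smul_eq_mul, zero_sub, neg_ne_zero]
        exact mul_ne_zero (mul_ne_zero h2 hb) (neg_ne_zero.2 hb0))
    exact ⟨g * refl B x, Subgroup.mul_mem _ hg hr, by rw [mul_smul, hgu]⟩
  · exact main u hu hn hue

end Transitivity

section Rigid

variable {K V : Type*} [Field K] [AddCommGroup V] [Module K V] {B : LinearMap.BilinForm K V}

/-- No nonzero vector of the radical of `M` is orthogonal to `x₀`. -/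
def RadicalDetects (B : LinearMap.BilinForm K V) (M : Submodule K V) (x₀ : V) : Prop :=
  ∀ z ∈ M, (∀ y ∈ M, B z y = 0) → B z x₀ = 0 → z = 0

theorem RadicalDetects.eq_one {M : Submodule K V} {x₀ : V} (hx : RadicalDetects B M x₀)
    (h2 : (2 : K) ≠ 0) (hB : B.IsSymm) {g : (Module.End K V)ˣ} (hg : g ∈ isom B)
    (hM : ∀ x, g • x - x ∈ M) (h1 : ∀ x ∈ M, g • x = x) : g = 1 := by
  have hrad : ∀ x, ∀ y ∈ M, B (g • x - x) y = 0 := by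
    intro x y hy
    have := isom_apply hg x y
    rw [h1 y hy] at this
    rw [map_sub, LinearMap.sub_apply, this, sub_self]
  have h0 : g • x₀ - x₀ = 0 := by
    refine hx _ (hM _) (hrad _) ?_
    have e1 := isom_apply hg x₀ x₀
    have e2 := hrad x₀ _ (hM x₀)
    have e3 := bsymm hB x₀ (g • x₀)
    simp only [map_sub, LinearMap.sub_apply] at e2 ⊢
    have : 2 * (B (g • x₀) x₀ - B x₀ x₀) = 0 := by linear_combination e1 - e2 - e3
    exact (mul_eq_zero.1 this).resolve_left h2
  refine units_ext fun x => ?_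
  rw [one_smul, ← sub_eq_zero]
  refine hx _ (hM _) (hrad _) ?_
  have e1 := isom_apply hg x x₀
  rw [sub_eq_zero.1 h0] at e1
  rw [map_sub, LinearMap.sub_apply, e1, sub_self]

theorem inv_smul_sub_mem {M : Submodule K V} {g : (Module.End K V)ˣ} (hM : ∀ x, g • x - x ∈ M)
    (x : V) : g⁻¹ • x - x ∈ M := by
  have := M.neg_mem (hM (g⁻¹ • x))
  rwa [smul_inv_smul, neg_sub] at this

theorem mul_smul_sub_mem {M : Submodule K V} {g h : (Module.End K V)ˣ}
    (hg : ∀ x, g • x - x ∈ M) (hh : ∀ x, h • x - x ∈ M) (x : V) : (g * h) • x - x ∈ M := by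
  have := M.add_mem (hg (h • x)) (hh x)
  rwa [sub_add_sub_cancel, ← mul_smul] at this

theorem smul_mem_of_sub_mem {M : Submodule K V} {g : (Module.End K V)ˣ} {x : V}
    (hg : g • x - x ∈ M) (hx : x ∈ M) : g • x ∈ M := by
  simpa using M.add_mem hg hx

theorem RadicalDetects.eq_of_eqOn {M : Submodule K V} {x₀ : V} (hx : RadicalDetects B M x₀)
    (h2 : (2 : K) ≠ 0) (hB : B.IsSymm) {g h : (Module.End K V)ˣ} (hg : g ∈ isom B)
    (hh : h ∈ isom B) (hgM : ∀ x, g • x - x ∈ M) (hhM : ∀ x, h • x - x ∈ M)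
    (hgh : ∀ x ∈ M, g • x = h • x) : g = h := by
  have := hx.eq_one h2 hB ((isom B).mul_mem ((isom B).inv_mem hh) hg)
    (mul_smul_sub_mem (inv_smul_sub_mem hhM) hgM)
    (fun x hx => by rw [mul_smul, hgh x hx, inv_smul_smul])
  exact (inv_mul_eq_one.1 this).symm

/-- Isometries acting trivially modulo `M` fix the radical of `M`. -/
theorem RadicalDetects.fix_radical {M : Submodule K V} {x₀ : V} (hx : RadicalDetects B M x₀)
    {g : (Module.End K V)ˣ} (hg : g ∈ isom B) (hM : ∀ x, g • x - x ∈ M) {z : V}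
    (hzM : ∀ y ∈ M, B z y = 0) : g • z = z := by
  have hr : ∀ y ∈ M, B (g • z) y = 0 := by
    intro y hy
    rw [← smul_inv_smul g y, isom_apply hg]
    exact hzM _ (smul_mem_of_sub_mem (inv_smul_sub_mem hM y) hy)
  rw [← sub_eq_zero]
  refine hx _ (hM z) (fun y hy => ?_) ?_
  · rw [map_sub, LinearMap.sub_apply, hr y hy, hzM y hy, sub_zero]
  · have e1 := isom_apply hg z x₀
    have e2 := hr _ (hM x₀)
    rw [map_sub] at e2
    rw [map_sub, LinearMap.sub_apply]
    linear_combination e1 - e2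

variable (B) in
/-- The linear map scaling a hyperbolic pair `e, f` by `lam, lam⁻¹` and fixing its orthogonal
complement. -/
def hypMap (e f : V) (lam : K) : Module.End K V :=
  1 - (B.flip f).smulRight ((lam - 1) • e) - (B.flip e).smulRight ((lam⁻¹ - 1) • f)

theorem hypMap_apply (e f : V) (lam : K) (x : V) :
    hypMap B e f lam x = x - ((lam - 1) * B x f) • e - ((lam⁻¹ - 1) * B x e) • f := by
  simp [hypMap, smul_smul, mul_comm]

theorem hypMap_mul_inv {e f : V} {lam : K} (hl : lam ≠ 0) (hee : B e e = 0) (hff : B f f = 0)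
    (hef : B e f = -1) (hfe : B f e = -1) : hypMap B e f lam * hypMap B e f lam⁻¹ = 1 := by
  ext x
  simp [hypMap_apply, hee, hff, hef, hfe]
  match_scalars <;> field_simp <;> ring

open Classical in
variable (B) in
/-- `hypMap` as an invertible map; the identity if `e, f` is not a hyperbolic pair. -/
noncomputable def hypUnit (e f : V) (lam : K) : (Module.End K V)ˣ :=
  if h : lam ≠ 0 ∧ B e e = 0 ∧ B f f = 0 ∧ B e f = -1 ∧ B f e = -1 then
    ⟨hypMap B e f lam, hypMap B e f lam⁻¹, hypMap_mul_inv h.1 h.2.1 h.2.2.1 h.2.2.2.1 h.2.2.2.2,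
      by simpa using hypMap_mul_inv (inv_ne_zero h.1) h.2.1 h.2.2.1 h.2.2.2.1 h.2.2.2.2⟩
  else 1

variable (B) in
/-- A hyperbolic pair. -/
structure HypPair (e f : V) : Prop where
  ee : B e e = 0
  ff : B f f = 0
  ef : B e f = -1
  fe : B f e = -1

theorem HypPair.unit_smul {e f : V} (h : HypPair B e f) {lam : K} (hl : lam ≠ 0) (x : V) :
    hypUnit B e f lam • x = x - ((lam - 1) * B x f) • e - ((lam⁻¹ - 1) * B x e) • f := by
  rw [hypUnit, dif_pos ⟨hl, h.ee, h.ff, h.ef, h.fe⟩, Units.smul_def, Module.End.smul_def]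
  exact hypMap_apply e f lam x

theorem HypPair.unit_mem_isom (hB : B.IsSymm) {e f : V} (h : HypPair B e f) {lam : K}
    (hl : lam ≠ 0) : hypUnit B e f lam ∈ isom B := by
  intro x y
  have h1 := bsymm hB e y
  have h2 := bsymm hB f y
  simp only [h.unit_smul hl, map_sub, map_smul, LinearMap.sub_apply, LinearMap.smul_apply,
    smul_eq_mul, h.ee, h.ff, h.ef, h.fe, h1, h2]
  field_simp
  ring

theorem HypPair.norm_sub {e f : V} (h : HypPair B e f) (h2 : (2 : K) ≠ 0) {s : K} (hs : s ≠ 0) :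
    B (s • e - (2 * s)⁻¹ • f) (s • e - (2 * s)⁻¹ • f) = 1 := by
  simp only [map_sub, map_smul, LinearMap.sub_apply, LinearMap.smul_apply,
    smul_eq_mul, h.ee, h.ff, h.ef, h.fe]
  field_simp
  ring

theorem HypPair.unit_sq {e f : V} (h : HypPair B e f) (h2 : (2 : K) ≠ 0) {s : K} (hs : s ≠ 0) :
    hypUnit B e f (s ^ 2) =
      refl B (s • e - (2 * s)⁻¹ • f) * refl B ((1 : K) • e - (2 * (1 : K))⁻¹ • f) := by
  refine units_ext fun x => ?_
  rw [mul_smul, refl_smul (h.norm_sub h2 one_ne_zero), refl_smul (h.norm_sub h2 hs),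
    h.unit_smul (pow_ne_zero 2 hs)]
  simp only [map_sub, map_smul, LinearMap.sub_apply, LinearMap.smul_apply,
    smul_eq_mul, h.ee, h.ff, h.ef, h.fe]
  match_scalars <;> field_simp <;> ring

end Rigid

section Witt

variable {p : ℕ} [Fact p.Prime] {V : Type*} [AddCommGroup V] [Module (ZMod p) V]
  {B : LinearMap.BilinForm (ZMod p) V}

/-- If `M` is spanned by norm `1` vectors, then `y ↦ y + B(y, w) ρ` is induced on `M` by
`reflGroup B M` for each `ρ` in the radical. -/
theorem exists_translation (hp : p ≠ 2) (hB : B.IsSymm) {M : Submodule (ZMod p) V}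
    (hspan : M ≤ Submodule.span (ZMod p) {a ∈ (M : Set V) | B a a = 1}) {ρ : V} (hρ : ρ ∈ M)
    (hρM : ∀ y ∈ M, B ρ y = 0) {w : V} (hw : w ∈ M) :
    ∃ g ∈ reflGroup B (M : Set V), ∀ y ∈ M, g • y = y + B y w • ρ := by
  have h2 := two_ne_zero_zmod hp
  have hMρ : ∀ y ∈ M, B y ρ = 0 := fun y hy => by rw [bsymm hB, hρM y hy]
  suffices ∀ a : ZMod p, w ∈ M ∧
      ∃ g ∈ reflGroup B (M : Set V), ∀ y ∈ M, g • y = y + (a * B y w) • ρ by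
    simpa using (this 1).2
  replace hw := hspan hw
  induction hw using Submodule.span_induction with
  | mem x hx =>
    obtain ⟨hxM, hxx⟩ := hx
    intro a
    have hn : B (x + (a / 2) • ρ) (x + (a / 2) • ρ) = 1 := by
      simp [hxx, hρM x hxM, hMρ x hxM, hρM ρ hρ]
    refine ⟨hxM, refl B (x + (a / 2) • ρ) * refl B x, Subgroup.mul_mem _
      (refl_mem_reflGroup (M.add_mem hxM (M.smul_mem _ hρ)) hn) (refl_mem_reflGroup hxM hxx),
      fun y hy => ?_⟩
    rw [mul_smul, refl_smul hxx, refl_smul hn]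
    simp only [map_add, map_sub, map_smul, LinearMap.sub_apply, LinearMap.smul_apply, smul_eq_mul,
      hxx, hMρ x hxM, hMρ y hy]
    match_scalars <;> field_simp <;> ring
  | zero => exact fun a => ⟨M.zero_mem, 1, Subgroup.one_mem _, by simp⟩
  | add w w' _ _ h h' =>
    intro a
    obtain ⟨hw, g, hg, hgy⟩ := h a
    obtain ⟨hw', g', hg', hgy'⟩ := h' a
    refine ⟨M.add_mem hw hw', g * g', Subgroup.mul_mem _ hg hg', fun y hy => ?_⟩
    rw [mul_smul, hgy' y hy, hgy _ (M.add_mem hy (M.smul_mem _ hρ))]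
    simp only [map_add, map_smul, LinearMap.add_apply, LinearMap.smul_apply, smul_eq_mul,
      hρM w hw]
    module
  | smul b w _ h =>
    intro a
    obtain ⟨hw, -⟩ := h 0
    obtain ⟨-, g, hg, hgy⟩ := h (a * b)
    refine ⟨M.smul_mem _ hw, g, hg, fun y hy => ?_⟩
    rw [hgy y hy, map_smul, smul_eq_mul, mul_assoc]

/-- An isometry preserving `M` can be corrected by `reflGroup B M` so as to fix an orthogonal
sequence in the complement of a hyperbolic pair. -/
theorem exists_fix_orthogonal (hp : p ≠ 2) (hp3 : p ≠ 3) (hB : B.IsSymm)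
    {M : Submodule (ZMod p) V} {e f : V} (hef : HypPair B e f) (he : e ∈ M) (hf : f ∈ M)
    {g : (Module.End (ZMod p) V)ˣ} (hg : g ∈ isom B) (hgM : ∀ x ∈ M, g • x ∈ M) {n : ℕ}
    (v : Fin n → V) (hv : ∀ i, v i ∈ M) (hve : ∀ i, B (v i) e = 0) (hvf : ∀ i, B (v i) f = 0)
    (horth : ∀ i j, i ≠ j → B (v i) (v j) = 0)
    (hiso : ∀ i, B (v i) (v i) = 0 → ∀ ν ∈ reflGroup B (M : Set V), (ν * g) • v i = v i)
    (k : ℕ) : ∃ ν ∈ reflGroup B (M : Set V), ∀ i : Fin n, (i : ℕ) < k → (ν * g) • v i = v i := by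
  induction k with
  | zero => exact ⟨1, Subgroup.one_mem _, fun i hi => absurd hi (Nat.not_lt_zero _)⟩
  | succ k ih =>
    obtain ⟨ν, hν, hfix⟩ := ih
    by_cases hkn : k < n
    swap
    · exact ⟨ν, hν, fun i _ => hfix i (by have := i.2; lia)⟩
    set K : Fin n := ⟨k, hkn⟩
    by_cases h0 : B (v K) (v K) = 0
    · refine ⟨ν, hν, fun i hi => ?_⟩
      rcases (Nat.lt_succ_iff_lt_or_eq.1 hi) with hi | hi
      · exact hfix i hi
      · rw [show i = K from Fin.ext hi]
        exact hiso K h0 ν hν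
    set X : Submodule (ZMod p) V :=
      M ⊓ ⨅ i : {i : Fin n // (i : ℕ) < k}, LinearMap.ker (B.flip (v i)) with hX
    have hXmem : ∀ x, x ∈ X ↔ x ∈ M ∧ ∀ i : Fin n, (i : ℕ) < k → B x (v i) = 0 := by
      intro x
      simp [hX, Submodule.mem_iInf]
    have hνi : ν * g ∈ isom B := (isom B).mul_mem (reflGroup_le_isom hB _ hν) hg
    obtain ⟨ν', hν', hu⟩ := HypTriple.exists_smul_eq (X := X) (u := (ν * g) • v K) hp hp3 hB
      (c := v K) (e := e) (f := f)
      ⟨rfl, hef.ee, hef.ff, hef.ef, hef.fe, hve K, by rw [bsymm hB, hve K], hvf K,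
        by rw [bsymm hB, hvf K]⟩ h0
      ((hXmem _).2 ⟨hv K, fun i hi => horth _ _ (Fin.ne_of_gt hi)⟩)
      ((hXmem _).2 ⟨he, fun i _ => by rw [bsymm hB, hve i]⟩)
      ((hXmem _).2 ⟨hf, fun i _ => by rw [bsymm hB, hvf i]⟩)
      ((hXmem _).2 ⟨by
        rw [mul_smul]
        exact reflGroup_smul_mem subset_rfl hν (hgM _ (hv K)), fun i hi => by
        rw [← hfix i hi, isom_apply hνi, horth _ _ (Fin.ne_of_gt hi)]⟩)
      (by rw [isom_apply hνi])
    refine ⟨ν' * ν, Subgroup.mul_mem _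
      (reflGroup_mono (fun x hx => ((hXmem x).1 hx).1) hν') hν, fun i hi => ?_⟩
    rw [mul_assoc, mul_smul]
    rcases (Nat.lt_succ_iff_lt_or_eq.1 hi) with hi | hi
    · rw [hfix i hi]
      refine reflGroup_fix hν' fun a ha => ?_
      rw [bsymm hB]
      exact ((hXmem a).1 ha).2 i hi
    · rw [show i = K from Fin.ext hi]
      exact hu

/-- The orthogonal complement of `e` and `f` in `M`. -/
def perp (B : LinearMap.BilinForm (ZMod p) V) (M : Submodule (ZMod p) V) (e f : V) :
    Submodule (ZMod p) V :=
  M ⊓ LinearMap.ker (B.flip e) ⊓ LinearMap.ker (B.flip f)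

theorem mem_perp {M : Submodule (ZMod p) V} {e f x : V} :
    x ∈ perp B M e f ↔ x ∈ M ∧ B x e = 0 ∧ B x f = 0 := by
  simp [perp, and_assoc]

theorem HypPair.sub_mem_perp {M : Submodule (ZMod p) V} {e f : V} (hef : HypPair B e f)
    (he : e ∈ M) (hf : f ∈ M) {x : V} (hx : x ∈ M) :
    x + B x f • e + B x e • f ∈ perp B M e f := by
  refine mem_perp.2 ⟨M.add_mem (M.add_mem hx (M.smul_mem _ he)) (M.smul_mem _ hf), ?_, ?_⟩ <;>
  simp [hef.ee, hef.ff, hef.ef, hef.fe]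

theorem exists_fix_perp [FiniteDimensional (ZMod p) V] (hp : p ≠ 2) (hp3 : p ≠ 3) (hB : B.IsSymm)
    {M : Submodule (ZMod p) V} {x₀ : V} (hx₀ : RadicalDetects B M x₀)
    {e f : V} (hef : HypPair B e f) (he : e ∈ M) (hf : f ∈ M)
    {g : (Module.End (ZMod p) V)ˣ} (hg : g ∈ isom B) (hgM : ∀ x, g • x - x ∈ M) :
    ∃ ν ∈ reflGroup B (M : Set V), ∀ y ∈ perp B M e f, (ν * g) • y = y := by
  have h2 := two_ne_zero_zmod hp
  have : Invertible (2 : ZMod p) := invertibleOfNonzero h2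
  obtain ⟨b, hb⟩ := LinearMap.BilinForm.exists_orthogonal_basis
    (B := B.domRestrict₁₂ (perp B M e f) (perp B M e f)) ⟨fun x y => bsymm hB (x : V) (y : V)⟩
  have horth : ∀ i j, i ≠ j → B (b i : V) (b j : V) = 0 :=
    fun i j hij => hb hij
  have hmem := fun i => mem_perp.1 (b i).2
  obtain ⟨ν, hν, hfix⟩ := exists_fix_orthogonal hp hp3 hB hef he hf hg
    (fun x hx => smul_mem_of_sub_mem (hgM x) hx) (fun i => (b i : V)) (fun i => (hmem i).1)
    (fun i => (hmem i).2.1) (fun i => (hmem i).2.2) horth (by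
      intro i hi ν hν
      have hY : ∀ y ∈ perp B M e f, B (b i : V) y = 0 := by
        intro y hy
        have : (perp B M e f) ≤ (LinearMap.ker (B (b i : V))) := by
          intro y hy
          have hs : (⟨y, hy⟩ : perp B M e f) ∈ Submodule.span (ZMod p) (Set.range b) :=
            b.mem_span _
          have hle : Submodule.span (ZMod p) (Set.range b) ≤
              (LinearMap.ker (B (b i : V))).comap (perp B M e f).subtype := by
            rw [Submodule.span_le]
            rintro _ ⟨j, rfl⟩
            rcases eq_or_ne i j with rfl | hij
            · simpa using hi
            · simpa using horth i j hij
          simpa using hle hs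
        simpa using this hy
      have hM : ∀ y ∈ M, B (b i : V) y = 0 := by
        intro y hy
        have := hY _ (hef.sub_mem_perp he hf hy)
        simpa [(hmem i).2.1, (hmem i).2.2] using this
      rw [mul_smul, hx₀.fix_radical hg hgM hM]
      exact reflGroup_fix hν fun a ha => hM a ha) (Module.finrank (ZMod p) (perp B M e f))
  refine ⟨ν, hν, fun y hy => ?_⟩
  have hs : (⟨y, hy⟩ : perp B M e f) ∈ Submodule.span (ZMod p) (Set.range b) := b.mem_span _
  have hle : Submodule.span (ZMod p) (Set.range b) ≤
      (LinearMap.eqLocus ((ν * g : (Module.End (ZMod p) V)ˣ) : Module.End (ZMod p) V)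
        LinearMap.id).comap (perp B M e f).subtype := by
    rw [Submodule.span_le]
    rintro _ ⟨j, rfl⟩
    exact hfix j j.2
  exact hle hs

end Witt

section Witt

variable {p : ℕ} [Fact p.Prime] {V : Type*} [AddCommGroup V] [Module (ZMod p) V]
  {B : LinearMap.BilinForm (ZMod p) V}

theorem exists_kill_radical (hp : p ≠ 2) (hB : B.IsSymm) {M : Submodule (ZMod p) V}
    (hspan : M ≤ Submodule.span (ZMod p) {a ∈ (M : Set V) | B a a = 1})
    {e f : V} (hef : HypPair B e f) (he : e ∈ M) (hf : f ∈ M)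
    {h : (Module.End (ZMod p) V)ˣ} (hh : h ∈ isom B) (hhM : ∀ x, h • x - x ∈ M)
    (hfix : ∀ y ∈ perp B M e f, h • y = y) {u v : V} (hu : u ∈ M) (hv : v ∈ M)
    (huy : ∀ y ∈ perp B M e f, B u y = 0) (hvy : ∀ y ∈ perp B M e f, B v y = 0)
    (huv : B u v = -1) (hvv : B v v = 0) :
    ∃ ν ∈ reflGroup B (M : Set V), (∀ y ∈ perp B M e f, (ν * h) • y = y) ∧
      (ν * h) • v = h • v ∧ ∃ α β : ZMod p, (ν * h) • u = α • e + β • f := by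
  have huM := smul_mem_of_sub_mem (hhM u) hu
  have hvM := smul_mem_of_sub_mem (hhM v) hv
  have hρ := hef.sub_mem_perp he hf huM
  set ρ := h • u + B (h • u) f • e + B (h • u) e • f with hρdef
  have hρ' := mem_perp.1 hρ
  have hρy : ∀ y ∈ perp B M e f, B ρ y = 0 := by
    intro y hy
    obtain ⟨-, hye, hyf⟩ := mem_perp.1 hy
    have h1 : B (h • u) y = 0 := by
      rw [← hfix y hy, isom_apply hh, huy y hy]
    rw [bsymm hB] at hye hyf
    simp [hρdef, h1, hye, hyf]
  have hρM : ∀ y ∈ M, B ρ y = 0 := by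
    intro y hy
    simpa [hρ'.2.1, hρ'.2.2] using hρy _ (hef.sub_mem_perp he hf hy)
  obtain ⟨ν, hν, hνy⟩ := exists_translation hp hB hspan hρ'.1 hρM hvM
  refine ⟨ν, hν, fun y hy => ?_, ?_, -B (h • u) f, -B (h • u) e, ?_⟩
  · rw [mul_smul, hfix y hy, hνy y (mem_perp.1 hy).1, ← hfix y hy, isom_apply hh, hfix y hy,
      bsymm hB, hvy y hy]
    simp
  · rw [mul_smul, hνy _ hvM, isom_apply hh, hvv]
    simp
  · rw [mul_smul, hνy _ huM, isom_apply hh, huv, hρdef]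
    generalize h • u = z
    module

theorem perp_orthogonal_left (hB : B.IsSymm) {M : Submodule (ZMod p) V} {e f : V} :
    ∀ y ∈ perp B M e f, B e y = 0 := fun y hy => by rw [bsymm hB]; exact (mem_perp.1 hy).2.1

theorem perp_orthogonal_right (hB : B.IsSymm) {M : Submodule (ZMod p) V} {e f : V} :
    ∀ y ∈ perp B M e f, B f y = 0 := fun y hy => by rw [bsymm hB]; exact (mem_perp.1 hy).2.2

/-- An isometry fixing the complement of `e, f` in `M` and scaling `e, f` is a `hypUnit`. -/
theorem eq_hypUnit (hp : p ≠ 2) (hB : B.IsSymm) {M : Submodule (ZMod p) V} {x₀ : V}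
    (hx₀ : RadicalDetects B M x₀) {e f : V} (hef : HypPair B e f) (he : e ∈ M) (hf : f ∈ M)
    {h : (Module.End (ZMod p) V)ˣ} (hh : h ∈ isom B) (hhM : ∀ x, h • x - x ∈ M)
    (hfix : ∀ y ∈ perp B M e f, h • y = y) {lam : ZMod p} (hl : lam ≠ 0)
    (h1 : h • e = lam • e) (h2 : h • f = lam⁻¹ • f) : h = hypUnit B e f lam := by
  refine hx₀.eq_of_eqOn (two_ne_zero_zmod hp) hB hh (hef.unit_mem_isom hB hl) hhM ?_ ?_
  · intro x
    rw [hef.unit_smul hl, sub_sub x, sub_sub_cancel_left]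
    exact M.neg_mem (M.add_mem (M.smul_mem _ he) (M.smul_mem _ hf))
  · intro x hx
    have hy := hef.sub_mem_perp he hf hx
    have hs : h • x = h • (x + B x f • e + B x e • f) - B x f • h • e - B x e • h • f := by
      rw [smul_add, smul_add, smul_comm h, smul_comm h, add_sub_right_comm, add_sub_cancel_right,
        add_sub_cancel_right]
    rw [hs, hfix _ hy, h1, h2, hef.unit_smul hl]
    module

theorem exists_mul_eq_hypUnit [FiniteDimensional (ZMod p) V] (hp : p ≠ 2) (hp3 : p ≠ 3)
    (hB : B.IsSymm) {M : Submodule (ZMod p) V}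
    (hspan : M ≤ Submodule.span (ZMod p) {a ∈ (M : Set V) | B a a = 1})
    {x₀ : V} (hx₀ : RadicalDetects B M x₀)
    {e f : V} (hef : HypPair B e f) (he : e ∈ M) (hf : f ∈ M)
    {g : (Module.End (ZMod p) V)ˣ} (hg : g ∈ isom B) (hgM : ∀ x, g • x - x ∈ M) :
    ∃ ν ∈ reflGroup B (M : Set V), ∃ lam : ZMod p, lam ≠ 0 ∧ ν * g = hypUnit B e f lam := by
  have h2 := two_ne_zero_zmod hp
  have hN : ∀ ν ∈ reflGroup B (M : Set V), ∀ h ∈ isom B, ν * h ∈ isom B := fun ν hν h hh =>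
    (isom B).mul_mem (reflGroup_le_isom hB _ hν) hh
  have hNM : ∀ ν ∈ reflGroup B (M : Set V), ∀ x, ν • x - x ∈ M := fun ν hν x =>
    reflGroup_sub_mem subset_rfl hν x
  obtain ⟨ν, hν, hfix⟩ := exists_fix_perp hp hp3 hB hx₀ hef he hf hg hgM
  have hi := hN ν hν g hg
  have hm := mul_smul_sub_mem (hNM ν hν) hgM
  obtain ⟨ν', hν', hfix', -, α, β, he'⟩ := exists_kill_radical hp hB hspan hef he hf hi hm hfix
    he hf (perp_orthogonal_left hB) (perp_orthogonal_right hB) hef.ef hef.ff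
  have hi' := hN ν' hν' _ hi
  have hm' := mul_smul_sub_mem (hNM ν' hν') hm
  obtain ⟨ν'', hν'', hfix'', he'', α', β', hf''⟩ := exists_kill_radical hp hB hspan hef he hf
    hi' hm' hfix' hf he (perp_orthogonal_right hB) (perp_orthogonal_left hB) hef.fe hef.ee
  have hi'' := hN ν'' hν'' _ hi'
  have hm'' := mul_smul_sub_mem (hNM ν'' hν'') hm'
  rw [he'] at he''
  set h := ν'' * (ν' * (ν * g)) with hh
  have q1 := isom_apply hi'' e e
  have q2 := isom_apply hi'' f f
  have q3 := isom_apply hi'' e f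
  simp only [he'', hf'', map_add, map_smul, LinearMap.add_apply, LinearMap.smul_apply,
    smul_eq_mul, hef.ee, hef.ff, hef.ef, hef.fe] at q1 q2 q3
  have q1' : α * β = 0 := by
    have : 2 * (α * β) = 0 := by linear_combination -q1
    exact (mul_eq_zero.1 this).resolve_left h2
  have q2' : α' * β' = 0 := by
    have : 2 * (α' * β') = 0 := by linear_combination -q2
    exact (mul_eq_zero.1 this).resolve_left h2
  have hνν := Subgroup.mul_mem _ hν'' (Subgroup.mul_mem _ hν' hν)
  rcases mul_eq_zero.1 q1' with rfl | rfl
  · have hβ : α' * β = 1 := by linear_combination -q3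
    have hβ0 : β ≠ 0 := right_ne_zero_of_mul_eq_one hβ
    have hα0 : α' ≠ 0 := left_ne_zero_of_mul_eq_one hβ
    obtain rfl : β' = 0 := (mul_eq_zero.1 q2').resolve_left hα0
    obtain rfl : α' = β⁻¹ := eq_inv_of_mul_eq_one_left hβ
    have hn := hef.norm_sub h2 one_ne_zero
    have hr : refl B ((1 : ZMod p) • e - (2 * (1 : ZMod p))⁻¹ • f) ∈ reflGroup B (M : Set V) :=
      refl_mem_reflGroup (M.sub_mem (M.smul_mem _ he) (M.smul_mem _ hf)) hn
    refine ⟨_, Subgroup.mul_mem _ hr hνν, 2 * β, mul_ne_zero h2 hβ0, ?_⟩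
    have hassoc : refl B ((1 : ZMod p) • e - (2 * (1 : ZMod p))⁻¹ • f) * (ν'' * (ν' * ν)) * g =
      refl B ((1 : ZMod p) • e - (2 * (1 : ZMod p))⁻¹ • f) * h := by
        rw [hh]; group
    rw [hassoc]
    refine eq_hypUnit hp hB hx₀ hef he hf (hN _ hr _ hi'')
      (mul_smul_sub_mem (hNM _ hr) hm'') (fun y hy => ?_) (mul_ne_zero h2 hβ0) ?_ ?_
    · obtain ⟨-, hye, hyf⟩ := mem_perp.1 hy
      rw [mul_smul, hfix'' y hy, refl_smul hn]
      simp [hye, hyf]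
    · rw [mul_smul, he'', refl_smul hn]
      simp only [map_add, map_sub, map_smul, LinearMap.add_apply, LinearMap.smul_apply,
        smul_eq_mul, hef.ee, hef.ff, hef.ef, hef.fe]
      match_scalars <;> field_simp <;> ring
    · rw [mul_smul, hf'', refl_smul hn]
      simp only [map_add, map_sub, map_smul, LinearMap.add_apply, LinearMap.smul_apply,
        smul_eq_mul, hef.ee, hef.ff, hef.ef, hef.fe]
      match_scalars <;> field_simp <;> ring
  · have hα : α * β' = 1 := by linear_combination -q3
    have hβ0 : β' ≠ 0 := right_ne_zero_of_mul_eq_one hα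
    have hα0 : α ≠ 0 := left_ne_zero_of_mul_eq_one hα
    obtain rfl : α' = 0 := (mul_eq_zero.1 q2').resolve_right hβ0
    obtain rfl : β' = α⁻¹ := eq_inv_of_mul_eq_one_right hα
    refine ⟨_, hνν, α, hα0, ?_⟩
    rw [show ν'' * (ν' * ν) * g = h by rw [hh]; group]
    exact eq_hypUnit hp hB hx₀ hef he hf hi'' hm'' hfix'' hα0 (by rw [he'']; simp)
      (by rw [hf'']; simp)

/-- An isometry acting trivially modulo the span of a chain lies in the group of the chain,
possibly up to a hyperbolic rotation with non-square multiplier. -/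
theorem IsChain.mem_or_exists [FiniteDimensional (ZMod p) V] (hp : p ≠ 2) (hp3 : p ≠ 3)
    (hB : B.IsSymm) {c : ℕ → V} {m : ℕ} (h : IsChain B m c) {x₀ : V}
    (hx₀ : RadicalDetects B (chainSpan c m) x₀)
    {g : (Module.End (ZMod p) V)ˣ} (hg : g ∈ isom B)
    (hgM : ∀ x, g • x - x ∈ chainSpan (K := ZMod p) c m) :
    g ∈ chainGroup B c m ∨ ∃ ν ∈ chainGroup B c m, ∃ (lam : ZMod p) (e f : V),
      ¬ IsSquare lam ∧ HypPair B e f ∧ ν * g = hypUnit B e f lam := by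
  have h2 := two_ne_zero_zmod hp
  have hN := h.chainGroup_le_isom hB
  have hNM : ∀ ν ∈ chainGroup B c m, ∀ x, ν • x - x ∈ chainSpan (K := ZMod p) c m :=
    fun ν hν x => reflGroup_sub_mem subset_rfl (h.chainGroup_le_reflGroup hν) x
  have key : ∀ m, IsChain B (m + 1) c → (∀ x, g • x - x ∈ chainSpan (K := ZMod p) c (m + 1)) →
      ∃ ν ∈ chainGroup B c (m + 1), (ν * g) • c 0 = c 0 := by
    intro m h hgM
    have hc := mem_chainSpan (K := ZMod p) (c := c) (show 0 < m + 1 by lia)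
    have n0 := h.norm 0 (by lia)
    obtain ⟨ν, hν, h1⟩ := IsChain.signEquiv hp hp3 hB m c h (g • c 0)
      (smul_mem_of_sub_mem (hgM _) hc) (by rw [isom_apply hg, n0])
    rcases h1 with h1 | h1
    · exact ⟨ν, hν, by rw [mul_smul, h1]⟩
    · refine ⟨refl B (c 0) * ν, Subgroup.mul_mem _ (refl_mem_chainGroup (by lia)) hν, ?_⟩
      rw [mul_smul, mul_smul, h1, refl_smul n0, map_neg, LinearMap.neg_apply, n0]
      module
  rcases m with _ | _ | _ | m
  · left
    convert Subgroup.one_mem _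
    refine units_ext fun x => ?_
    have := hgM x
    rw [chainSpan_zero, Submodule.mem_bot, sub_eq_zero] at this
    rw [this, one_smul]
  · left
    obtain ⟨ν, hν, h1⟩ := key 0 h hgM
    have := hx₀.eq_one h2 hB ((isom B).mul_mem (hN hν) hg) (mul_smul_sub_mem (hNM ν hν) hgM) (by
      intro x hx
      obtain ⟨a, rfl⟩ := mem_chainSpan_one hx
      rw [smul_comm, h1])
    rw [eq_inv_of_mul_eq_one_right this]
    exact Subgroup.inv_mem _ hν
  · left
    obtain ⟨ν, hν, h1⟩ := key 1 h hgM
    have n0 := h.norm 0 (by lia)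
    have n1 := h.norm 1 (by lia)
    have a0 : B (c 0) (c 1) = -1 := h.adj 0 (by lia)
    have a0' : B (c 1) (c 0) = -1 := h.adj' 0 (by lia)
    have hi := (isom B).mul_mem (hN hν) hg
    have hm := mul_smul_sub_mem (hNM ν hν) hgM
    have h3 : (ν * g) • (c 0 + c 1) = c 0 + c 1 := by
      refine hx₀.fix_radical hi hm fun y hy => ?_
      obtain ⟨a, b, rfl⟩ := mem_chainSpan_two hy
      simp [n0, n1, a0, a0']
      ring
    rw [smul_add, h1, add_right_inj] at h3
    have := hx₀.eq_one h2 hB hi hm (by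
      intro x hx
      obtain ⟨a, b, rfl⟩ := mem_chainSpan_two hx
      rw [smul_add, smul_comm, h1, smul_comm, h3])
    rw [eq_inv_of_mul_eq_one_right this]
    exact Subgroup.inv_mem _ hν
  · have T := h.hypTriple (by lia)
    have hc0 := mem_chainSpan (K := ZMod p) (c := c) (show 0 < m + 3 by lia)
    have hc1 := mem_chainSpan (K := ZMod p) (c := c) (show 1 < m + 3 by lia)
    have hc2 := mem_chainSpan (K := ZMod p) (c := c) (show 2 < m + 3 by lia)
    have hef : HypPair B (c 0 + c 1) (c 1 + c 2) := ⟨T.ee, T.ff, T.ef, T.fe⟩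
    have he := Submodule.add_mem _ hc0 hc1
    have hf := Submodule.add_mem _ hc1 hc2
    obtain ⟨ν, hν, lam, hl, hνg⟩ := exists_mul_eq_hypUnit hp hp3 hB (by
      rw [chainSpan]
      refine Submodule.span_mono ?_
      rintro _ ⟨i, hi, rfl⟩
      exact ⟨mem_chainSpan hi, h.norm i hi⟩) hx₀ hef he hf hg hgM
    have hν' := hν
    rw [← h.chainGroup_eq hp hp3 hB] at hν'
    by_cases hsq : IsSquare lam
    · left
      obtain ⟨s, rfl⟩ := hsq
      have hs : s ≠ 0 := by
        rintro rfl
        simp at hl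
      rw [← sq, hef.unit_sq h2 hs] at hνg
      rw [eq_inv_mul_of_mul_eq hνg, h.chainGroup_eq hp hp3 hB]
      exact Subgroup.mul_mem _ (Subgroup.inv_mem _ hν) (Subgroup.mul_mem _
        (refl_mem_reflGroup (Submodule.sub_mem _ (Submodule.smul_mem _ _ he)
          (Submodule.smul_mem _ _ hf)) (hef.norm_sub h2 hs))
        (refl_mem_reflGroup (Submodule.sub_mem _ (Submodule.smul_mem _ _ he)
          (Submodule.smul_mem _ _ hf)) (hef.norm_sub h2 one_ne_zero)))
    · exact Or.inr ⟨ν, hν', lam, _, _, hsq, hef, hνg⟩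

end Witt

section Sign

open Equiv.Perm Classical

theorem sign_mulLeft_generator {F : Type*} [Field F] [Fintype F] (hF : ringChar F ≠ 2) {g : Fˣ}
    (hg : ∀ x : Fˣ, x ∈ Subgroup.zpowers g) : sign (Equiv.mulLeft g) = -1 := by
  have hne : g ≠ 1 := by
    rintro rfl
    have h1 := hg (-1)
    rw [Subgroup.zpowers_one_eq_bot, Subgroup.mem_bot] at h1
    exact Ring.neg_one_ne_one_of_char_ne_two hF (by simpa using congrArg Units.val h1)
  have hpow : ∀ k : ℤ, (Equiv.mulLeft g) ^ k = Equiv.mulLeft (g ^ k) := by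
    intro k
    exact (map_zpow (MulAction.toPermHom Fˣ Fˣ) g k).symm
  have hc : IsCycle (Equiv.mulLeft g) := by
    refine ⟨1, by simpa using hne, fun y _ => ?_⟩
    obtain ⟨k, hk⟩ := hg y
    exact ⟨k, by rw [hpow]; simpa using hk⟩
  have hs : (Equiv.mulLeft g).support = Finset.univ := by
    ext x
    simpa using hne
  rw [hc.sign, hs, Finset.card_univ, Fintype.card_units]
  have hodd := FiniteField.odd_card_of_char_ne_two hF
  have : Even (Fintype.card F - 1) := by
    obtain ⟨k, hk⟩ := Nat.odd_iff.2 hodd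
    exact ⟨k, by lia⟩
  rw [this.neg_one_pow]

/-- Multiplication by a non-square is an odd permutation. -/
theorem sign_mulLeft_of_not_isSquare {F : Type*} [Field F] [Fintype F] (hF : ringChar F ≠ 2)
    {u : Fˣ} (hu : ¬ IsSquare u) : sign (Equiv.mulLeft u) = -1 := by
  obtain ⟨g, hg⟩ := IsCyclic.exists_generator (α := Fˣ)
  obtain ⟨k, rfl⟩ := hg u
  have hk : Odd k := by
    by_contra h
    obtain ⟨j, rfl⟩ := Int.not_odd_iff_even.1 h
    exact hu ⟨g ^ j, zpow_add g j j⟩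
  have hpow : Equiv.mulLeft (g ^ k) = (Equiv.mulLeft g) ^ k :=
    map_zpow (MulAction.toPermHom Fˣ Fˣ) g k
  change sign (Equiv.mulLeft (g ^ k)) = -1
  rw [hpow, map_zpow, sign_mulLeft_generator hF hg, hk.neg_one_zpow]

variable {K V : Type*} [Field K] [AddCommGroup V] [Module K V] {B : LinearMap.BilinForm K V}

variable (B) in
/-- The action of isometries on the vectors of norm `1`. -/
def spherePerm : isom B →* Equiv.Perm {v : V // B v v = 1} where
  toFun g :=
    { toFun := fun x => ⟨g.1 • x.1, by rw [isom_apply g.2, x.2]⟩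
      invFun := fun x => ⟨g.1⁻¹ • x.1, by rw [isom_apply ((isom B).inv_mem g.2), x.2]⟩
      left_inv := fun x => by simp
      right_inv := fun x => by simp }
  map_one' := by ext; simp
  map_mul' g h := by ext; simp [mul_smul]

variable (B) in
/-- The parity of the action of an isometry on the vectors of norm `1`. -/
noncomputable def sphereSign [Fintype V] : isom B →* ℤˣ := sign.comp (spherePerm B)

theorem sphereSign_refl_eq [Fintype V] (hB : B.IsSymm) {u v : V} (hu : B u u = 1)
    (hv : B v v = 1) (h : SignEquiv (isom B) u v) :
    sphereSign B ⟨refl B u, refl_mem_isom hB hu⟩ = sphereSign B ⟨refl B v, refl_mem_isom hB hv⟩ := by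
  obtain ⟨g, hg, h⟩ := h
  have hr : refl B v = g * refl B u * g⁻¹ := by
    rw [← refl_conj hg hu]
    rcases h with h | h <;> simp [h, refl_neg]
  have : (⟨refl B v, refl_mem_isom hB hv⟩ : isom B) =
      ⟨g, hg⟩ * ⟨refl B u, refl_mem_isom hB hu⟩ * ⟨g, hg⟩⁻¹ := Subtype.ext hr
  rw [this, map_mul, map_mul, map_inv, mul_inv_cancel_comm]

end Sign

section SignHyp

open Equiv.Perm Classical

variable {p : ℕ} [Fact p.Prime] {V : Type*} [AddCommGroup V] [Module (ZMod p) V]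
  {B : LinearMap.BilinForm (ZMod p) V}

theorem sphereSign_hypUnit [Fintype V] (hp : p ≠ 2) (hB : B.IsSymm) {e f : V}
    (hef : HypPair B e f) {lam : ZMod p} (hl : lam ≠ 0) (hsq : ¬ IsSquare lam) :
    sphereSign B ⟨hypUnit B e f lam, hef.unit_mem_isom hB hl⟩ = -1 := by
  have h2 := two_ne_zero_zmod hp
  have hchar : ringChar (ZMod p) ≠ 2 := by rwa [ZMod.ringChar_zmod_n]
  set Y := perp B ⊤ e f with hY
  have hY1 : ∀ y : Y, B y e = 0 ∧ B y f = 0 := fun y => (mem_perp.1 y.2).2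
  have hY2 : ∀ y : Y, B e y = 0 ∧ B f y = 0 := fun y => by
    rw [bsymm hB e, bsymm hB f]; exact hY1 y
  let u : (ZMod p)ˣ := Units.mk0 lam hl
  have hu : ¬ IsSquare u⁻¹ := by
    rw [isSquare_inv]
    rintro ⟨s, hs⟩
    exact hsq ⟨s, by simpa [u] using congrArg Units.val hs⟩
  let F₁ : Y × (ZMod p)ˣ → {v : V // B v v = 1} := fun q =>
    ⟨q.1 + ((1 - B q.1 q.1) / (2 * q.2)) • e - (q.2 : ZMod p) • f, by
      have := q.2.ne_zero
      simp only [map_add, map_sub, map_smul, LinearMap.add_apply, LinearMap.sub_apply,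
        LinearMap.smul_apply, smul_eq_mul, hef.ee, hef.ff, hef.ef, hef.fe, (hY1 q.1).1,
        (hY1 q.1).2, (hY2 q.1).1, (hY2 q.1).2]
      field_simp
      ring⟩
  let F₂ : {y : Y // B y.1 y.1 = 1} × ZMod p → {v : V // B v v = 1} := fun q =>
    ⟨q.1.1 - q.2 • e, by
      simp only [map_sub, map_smul, LinearMap.sub_apply,
        LinearMap.smul_apply, smul_eq_mul, hef.ee, (hY1 q.1).1, (hY2 q.1).1, q.1.2]
      ring⟩
  have hF₁e : ∀ q, B (F₁ q).1 e = q.2 := fun q => by simp [F₁, hef.ee, hef.fe, (hY1 q.1).1]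
  have hF₂e : ∀ q, B (F₂ q).1 e = 0 := fun q => by simp [F₂, hef.ee, (hY1 q.1).1]
  have hF₁f : ∀ q, B (F₁ q).1 f = - ((1 - B q.1 q.1) / (2 * q.2)) := fun q => by
    simp [F₁, hef.ff, hef.ef, (hY1 q.1).2]
  have hF₂f : ∀ q, B (F₂ q).1 f = q.2 := fun q => by
    simp [F₂, hef.ef, (hY1 q.1).2]
  have hbij : Function.Bijective (Sum.elim F₁ F₂) := by
    constructor
    · refine Function.Injective.sumElim ?_ ?_ ?_
      · intro q q' h
        have h1 : q.2 = q'.2 := Units.ext (by rw [← hF₁e, ← hF₁e, h])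
        have h2 : (1 - B q.1 q.1) / (2 * q.2) = (1 - B q'.1 q'.1) / (2 * q'.2 : ZMod p) := by
          rw [← neg_inj, ← hF₁f, ← hF₁f, h]
        have h3 := congrArg Subtype.val h
        simp only [F₁, h2] at h3
        rw [h1] at h3
        exact Prod.ext (Subtype.ext (by simpa using h3)) h1
      · intro q q' h
        have h1 : q.2 = q'.2 := by rw [← hF₂f, ← hF₂f, h]
        have h3 := congrArg Subtype.val h
        simp only [F₂, h1] at h3
        exact Prod.ext (Subtype.ext (Subtype.ext (by simpa using h3))) h1
      · intro q q' h
        refine q.2.ne_zero ?_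
        rw [← hF₁e, h, hF₂e]
    · rintro ⟨v, hv⟩
      have hy := hef.sub_mem_perp (M := ⊤) trivial trivial (x := v) trivial
      have hyy : B (v + B v f • e + B v e • f) (v + B v f • e + B v e • f) =
          1 + 2 * B v e * B v f := by
        have s1 := bsymm hB e v
        have s2 := bsymm hB f v
        simp only [map_add, map_smul, LinearMap.add_apply, LinearMap.smul_apply, smul_eq_mul,
          hef.ee, hef.ff, hef.ef, hef.fe, hv, s1, s2]
        ring
      by_cases hve : B v e = 0
      · refine ⟨Sum.inr (⟨⟨_, hy⟩, by simpa [hve] using hyy⟩, B v f), Subtype.ext ?_⟩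
        simp [F₂, hve]
      · refine ⟨Sum.inl (⟨_, hy⟩, Units.mk0 _ hve), Subtype.ext ?_⟩
        simp only [F₁, Sum.elim_inl, Units.val_mk0, hyy]
        rw [show (1 - (1 + 2 * B v e * B v f)) / (2 * B v e) = - B v f by field_simp; ring]
        module
  let τ : Equiv.Perm ((Y × (ZMod p)ˣ) ⊕ ({y : Y // B y.1 y.1 = 1} × ZMod p)) :=
    Equiv.Perm.sumCongr (Equiv.prodCongrRight fun _ => Equiv.mulLeft u⁻¹)
      (Equiv.prodCongrRight fun _ => Equiv.mulLeft₀ lam hl)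
  have hτ : sphereSign B ⟨hypUnit B e f lam, hef.unit_mem_isom hB hl⟩ = sign τ := by
    rw [sphereSign, MonoidHom.comp_apply]
    have := sign_eq_sign_of_equiv τ (spherePerm B ⟨hypUnit B e f lam, hef.unit_mem_isom hB hl⟩)
      (Equiv.ofBijective _ hbij) ?_
    · convert this.symm
    rintro (⟨y, w⟩ | ⟨y, t⟩)
    · refine Subtype.ext ?_
      have := w.ne_zero
      simp only [τ, Equiv.ofBijective_apply, Equiv.Perm.sumCongr_apply, Sum.map_inl, Sum.elim_inl,
        Equiv.prodCongrRight_apply, spherePerm, MonoidHom.coe_mk, OneHom.coe_mk, Equiv.coe_fn_mk]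
      rw [hef.unit_smul hl, hF₁e, hF₁f]
      simp only [F₁, Equiv.coe_mulLeft, Units.val_mul, u, Units.val_inv_eq_inv_val, Units.val_mk0]
      match_scalars <;> field_simp <;> ring
    · refine Subtype.ext ?_
      simp only [τ, Equiv.ofBijective_apply, Equiv.Perm.sumCongr_apply, Sum.map_inr, Sum.elim_inr,
        Equiv.prodCongrRight_apply, spherePerm, MonoidHom.coe_mk, OneHom.coe_mk, Equiv.coe_fn_mk]
      rw [hef.unit_smul hl, hF₂e, hF₂f]
      simp only [F₂, Equiv.mulLeft₀_apply]
      module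
  have hodd : Odd (Fintype.card Y) := by
    rw [Module.card_eq_pow_finrank (K := ZMod p) (V := Y), ZMod.card]
    exact ((Fact.out : p.Prime).odd_of_ne_two hp).pow
  have hu' : sign (Equiv.mulLeft u⁻¹) = -1 := by
    convert sign_mulLeft_of_not_isSquare hchar hu
  rw [hτ, sign_sumCongr, sign_prodCongrRight, sign_prodCongrRight,
    Finset.prod_const, hu', Finset.card_univ, hodd.neg_one_pow]
  have hinv : ∏ _y : {y : Y // B y.1 y.1 = 1}, sign (Equiv.mulLeft₀ lam hl) = 1 := by
    refine Finset.prod_involution (fun y _ => ⟨-y.1, by simpa using y.2⟩) ?_ ?_ ?_ ?_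
    · intro y _
      exact Int.units_mul_self _
    · intro y _ _ h
      have h1 : -(y.1.1) = y.1.1 := congrArg (fun z => z.1.1) h
      have h3 : (2 : ZMod p) • y.1.1 = 0 := by
        rw [two_smul]
        nth_rewrite 1 [← h1]
        exact neg_add_cancel _
      have h4 : y.1.1 = 0 := (smul_eq_zero.1 h3).resolve_left h2
      have := y.2
      rw [h4] at this
      simp at this
    · intro y _
      exact Finset.mem_univ _
    · intro y _
      simp
  rw [hinv, mul_one]

end SignHyp

section Det

variable {K V : Type*} [Field K] [AddCommGroup V] [Module K V] [FiniteDimensional K V]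
  {B : LinearMap.BilinForm K V}

theorem det_refl {a : V} (h : B a a = 1) : LinearMap.det (refl B a).1 = -1 := by
  have : (refl B a).1 = LinearMap.transvection (B.flip a) ((-2 : K) • a) := by
    ext x
    have := refl_smul h x
    rw [Units.smul_def, Module.End.smul_def] at this
    rw [this, LinearMap.transvection.apply, LinearMap.BilinForm.flip_apply]
    module
  rw [this, LinearMap.transvection.det, LinearMap.BilinForm.flip_apply, map_smul, LinearMap.smul_apply, h,
    smul_eq_mul]
  ring

theorem HypPair.det_unit {e f : V} (hef : HypPair B e f) {lam : K}
    (hl : lam ≠ 0) : LinearMap.det (hypUnit B e f lam).1 = 1 := by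
  have : (hypUnit B e f lam).1 =
      LinearMap.transvection (B.flip (lam • e - f)) ((-lam⁻¹ : K) • (lam • e - f)) *
        LinearMap.transvection (B.flip (e - f)) (-(e - f)) := by
    ext x
    have := hef.unit_smul hl x
    rw [Units.smul_def, Module.End.smul_def] at this
    rw [this]
    simp only [Module.End.mul_apply, LinearMap.transvection.apply, LinearMap.BilinForm.flip_apply, map_add,
      map_sub, map_smul, LinearMap.smul_apply, LinearMap.sub_apply, map_neg,
      hef.ee, hef.ff, hef.ef, hef.fe, smul_eq_mul]
    match_scalars <;> field_simp <;> ring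
  rw [this, map_mul, LinearMap.transvection.det, LinearMap.transvection.det]
  simp only [LinearMap.BilinForm.flip_apply, map_sub, map_smul, LinearMap.smul_apply, LinearMap.sub_apply,
    map_neg, hef.ee, hef.ff, hef.ef, hef.fe, smul_eq_mul]
  field_simp
  ring

end Det

section Exclude

variable {p : ℕ} [Fact p.Prime] {V : Type*} [AddCommGroup V] [Module (ZMod p) V] [Fintype V]
  {B : LinearMap.BilinForm (ZMod p) V}

/-- In a group generated by reflections of equal parity, parity and determinant agree, so the
group contains no hyperbolic isometry with a non-square eigenvalue. -/
theorem hypUnit_not_mem_closure (hp : p ≠ 2) (hB : B.IsSymm) {S : Set V} {s : ℤˣ}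
    (hS : ∀ a ∈ S, ∃ h : B a a = 1, sphereSign B ⟨refl B a, refl_mem_isom hB h⟩ = s) {e f : V}
    (hef : HypPair B e f) {lam : ZMod p} (hsq : ¬ IsSquare lam) :
    hypUnit B e f lam ∉ Subgroup.closure (refl B '' S) := by
  have h2 := two_ne_zero_zmod hp
  have hl : lam ≠ 0 := by
    rintro rfl
    exact hsq ⟨0, by simp⟩
  have key : ∀ g ∈ Subgroup.closure (refl B '' S), ∃ hg : g ∈ isom B,
      (LinearMap.det g.1 = 1 ∧ sphereSign B ⟨g, hg⟩ = 1) ∨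
        (LinearMap.det g.1 = -1 ∧ sphereSign B ⟨g, hg⟩ = s) := by
    intro g hg
    refine Subgroup.closure_induction (p := fun g _ => ∃ hg : g ∈ isom B,
      (LinearMap.det g.1 = 1 ∧ sphereSign B ⟨g, hg⟩ = 1) ∨
        (LinearMap.det g.1 = -1 ∧ sphereSign B ⟨g, hg⟩ = s)) ?_ ?_ ?_ ?_ hg
    · rintro _ ⟨a, ha, rfl⟩
      obtain ⟨h, hs⟩ := hS a ha
      exact ⟨refl_mem_isom hB h, Or.inr ⟨det_refl h, hs⟩⟩
    · exact ⟨(isom B).one_mem, Or.inl ⟨by simp, map_one (sphereSign B)⟩⟩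
    · rintro g h - - ⟨hg, h1⟩ ⟨hh, h2⟩
      have e1 : sphereSign B ⟨g * h, (isom B).mul_mem hg hh⟩ =
        sphereSign B ⟨g, hg⟩ * sphereSign B ⟨h, hh⟩ := map_mul (sphereSign B) ⟨g, hg⟩ ⟨h, hh⟩
      refine ⟨(isom B).mul_mem hg hh, ?_⟩
      rw [e1, Units.val_mul, map_mul]
      rcases h1 with ⟨a, b⟩ | ⟨a, b⟩ <;> rcases h2 with ⟨c, d⟩ | ⟨c, d⟩ <;>
        simp [a, b, c, d, Int.units_mul_self]
    · rintro g - ⟨hg, h1⟩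
      have e1 : sphereSign B ⟨g⁻¹, (isom B).inv_mem hg⟩ =
        (sphereSign B ⟨g, hg⟩)⁻¹ := map_inv (sphereSign B) ⟨g, hg⟩
      have e2 : LinearMap.det (g⁻¹).1 * LinearMap.det g.1 = 1 := by
        rw [← map_mul, ← Units.val_mul, inv_mul_cancel, Units.val_one, map_one]
      refine ⟨(isom B).inv_mem hg, ?_⟩
      rw [e1, Int.units_inv_eq_self]
      rcases h1 with ⟨a, b⟩ | ⟨a, b⟩
      · exact Or.inl ⟨by rw [a, mul_one] at e2; exact e2, b⟩
      · exact Or.inr ⟨by rw [a] at e2; linear_combination -e2, b⟩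
  intro hmem
  obtain ⟨hg, ⟨-, h⟩ | ⟨h, -⟩⟩ := key _ hmem
  · rw [sphereSign_hypUnit hp hB hef hl hsq] at h
    exact absurd h (by decide)
  · rw [hef.det_unit hl] at h
    exact h2 (by linear_combination h)

/-- Adjacent nodes of the diagram have reflections of equal parity. -/
theorem sphereSign_refl_eq_of_adj (hp : p ≠ 2) (hB : B.IsSymm) {u v : V} (hu : B u u = 1)
    (hv : B v v = 1) (h : B u v = -1 ∨ B u v = -2⁻¹) :
    sphereSign B ⟨refl B u, refl_mem_isom hB hu⟩ =
      sphereSign B ⟨refl B v, refl_mem_isom hB hv⟩ := by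
  have h2 := two_ne_zero_zmod hp
  have hs := bsymm hB v u
  refine sphereSign_refl_eq hB hu hv ?_
  rcases h with h | h
  · have hw : B ((2⁻¹ : ZMod p) • (u - v)) ((2⁻¹ : ZMod p) • (u - v)) = 1 := by
      simp only [map_smul, map_sub, LinearMap.smul_apply, LinearMap.sub_apply, hu, hv, hs, h,
        smul_eq_mul]
      field_simp
      ring
    refine SignEquiv.of_refl hw (refl_mem_isom hB hw) (Or.inl ?_)
    simp only [map_smul, map_sub, hu, h, smul_eq_mul]
    match_scalars <;> field_simp <;> ring
  · refine SignEquiv.trans (v := u + v) ?_ (SignEquiv.symm ?_)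
    · refine SignEquiv.of_refl hv (refl_mem_isom hB hv) (Or.inl ?_)
      rw [h]
      match_scalars <;> field_simp
    · refine SignEquiv.of_refl hu (refl_mem_isom hB hu) (Or.inl ?_)
      rw [hs, h]
      match_scalars <;> field_simp

end Exclude

section Intervals

variable {G : Type*} [Group G] (r : ℕ → G)

/-- The subgroup generated by the elements of a family with index in a given set. -/
def gp (I : Set ℕ) : Subgroup G := Subgroup.closure (r '' I)

variable {r}

theorem gp_mono {I J : Set ℕ} (h : I ⊆ J) : gp r I ≤ gp r J :=
  Subgroup.closure_mono (Set.image_mono h)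

theorem mem_gp {I : Set ℕ} {i : ℕ} (h : i ∈ I) : r i ∈ gp r I :=
  Subgroup.subset_closure ⟨i, h, rfl⟩

theorem gp_le {I : Set ℕ} {H : Subgroup G} (h : ∀ i ∈ I, r i ∈ H) : gp r I ≤ H := by
  rw [gp, Subgroup.closure_le]
  rintro _ ⟨i, hi, rfl⟩
  exact h i hi

theorem gp_commute {I J : Set ℕ} (h : ∀ i ∈ I, ∀ j ∈ J, r i * r j = r j * r i) {x y : G}
    (hx : x ∈ gp r I) (hy : y ∈ gp r J) : x * y = y * x := by
  have h1 : gp r I ≤ Subgroup.centralizer (r '' J) := gp_le fun i hi => by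
    rw [Subgroup.mem_centralizer_iff]
    rintro _ ⟨j, hj, rfl⟩
    exact (h i hi j hj).symm
  have h2 : gp r J ≤ Subgroup.centralizer (gp r I : Set G) := gp_le fun j hj => by
    rw [Subgroup.mem_centralizer_iff]
    intro z hz
    exact ((Subgroup.mem_centralizer_iff.1 (h1 hz)) _ ⟨j, hj, rfl⟩).symm
  exact (Subgroup.mem_centralizer_iff.1 (h2 hy)) x hx

theorem exists_mul_of_mem_gp (hc : ∀ i j, i + 2 ≤ j → r i * r j = r j * r i) {I : Set ℕ} {k : ℕ}
    (hk : k ∉ I) {g : G} (hg : g ∈ gp r I) :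
    ∃ x ∈ gp r (I ∩ Set.Iio k), ∃ y ∈ gp r (I ∩ Set.Ioi k), g = x * y := by
  have hcomm : ∀ {x y : G}, x ∈ gp r (I ∩ Set.Iio k) → y ∈ gp r (I ∩ Set.Ioi k) →
      x * y = y * x := gp_commute fun i hi j hj => hc i j (by
    have h1 : i < k := hi.2
    have h2 : k < j := hj.2
    lia)
  refine Subgroup.closure_induction (p := fun g _ => ∃ x ∈ gp r (I ∩ Set.Iio k),
    ∃ y ∈ gp r (I ∩ Set.Ioi k), g = x * y) ?_ ?_ ?_ ?_ hg
  · rintro _ ⟨i, hi, rfl⟩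
    rcases lt_trichotomy i k with h | rfl | h
    · exact ⟨r i, mem_gp ⟨hi, h⟩, 1, one_mem _, by simp⟩
    · exact absurd hi hk
    · exact ⟨1, one_mem _, r i, mem_gp ⟨hi, h⟩, by simp⟩
  · exact ⟨1, one_mem _, 1, one_mem _, by simp⟩
  · rintro _ _ - - ⟨x, hx, y, hy, rfl⟩ ⟨x', hx', y', hy', rfl⟩
    refine ⟨x * x', mul_mem hx hx', y * y', mul_mem hy hy', ?_⟩
    rw [mul_assoc, ← mul_assoc y, ← hcomm hx' hy]
    simp only [mul_assoc]
  · rintro _ - ⟨x, hx, y, hy, rfl⟩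
    refine ⟨x⁻¹, inv_mem hx, y⁻¹, inv_mem hy, ?_⟩
    rw [hcomm hx hy, mul_inv_rev]

/-- Intersection property for intervals. -/
theorem gp_Ico_inf_le {n : ℕ} (H : ∀ a b, a < b → b < n →
      gp r (Set.Ico a b) ⊓ gp r (Set.Ico (a + 1) (b + 1)) ≤ gp r (Set.Ico (a + 1) b))
    {a b c d : ℕ} (hac : a ≤ c) (hbd : b ≤ d) (hd : d ≤ n) :
    gp r (Set.Ico a b) ⊓ gp r (Set.Ico c d) ≤ gp r (Set.Ico c b) := by
  obtain ⟨N, hN⟩ : ∃ N, d - a ≤ N := ⟨_, le_rfl⟩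
  induction N generalizing a b c d with
  | zero =>
    refine inf_le_right.trans (gp_mono fun i hi => ?_)
    simp only [Set.mem_Ico] at *
    lia
  | succ N ih =>
    rcases hac.eq_or_lt with rfl | hac
    · exact inf_le_left
    rcases hbd.eq_or_lt with rfl | hbd
    · exact inf_le_right
    obtain ⟨e, rfl⟩ : ∃ e, d = e + 1 := ⟨d - 1, by lia⟩
    by_cases hae : a < e
    · rintro x ⟨h1, h2⟩
      have h3 : x ∈ gp r (Set.Ico (a + 1) e) := H a e hae (by lia)
        ⟨gp_mono (Set.Ico_subset_Ico_right (by lia)) h1,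
          gp_mono (Set.Ico_subset_Ico_left (by lia)) h2⟩
      have h4 : x ∈ gp r (Set.Ico (a + 1) b) :=
        ih (by lia) (by lia) (by lia) (by lia) ⟨h1, h3⟩
      exact ih (by lia) (by lia) (by lia) (by lia) ⟨h4, h2⟩
    · refine inf_le_right.trans (gp_mono fun i hi => ?_)
      simp only [Set.mem_Ico] at *
      lia

/-- The intersection property follows from the one for overlapping intervals. -/
theorem gp_inf_le {n : ℕ} (hc : ∀ i j, i + 2 ≤ j → r i * r j = r j * r i)
    (H : ∀ a b, a < b → b < n →
      gp r (Set.Ico a b) ⊓ gp r (Set.Ico (a + 1) (b + 1)) ≤ gp r (Set.Ico (a + 1) b))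
    {a b : ℕ} (hb : b ≤ n) {I J : Set ℕ} (hI : I ⊆ Set.Ico a b) (hJ : J ⊆ Set.Ico a b) :
    gp r I ⊓ gp r J ≤ gp r (I ∩ J) := by
  obtain ⟨N, hN⟩ : ∃ N, b - a ≤ N := ⟨_, le_rfl⟩
  induction N generalizing a b I J with
  | zero =>
    refine inf_le_left.trans (gp_mono fun i hi => ?_)
    have := hI hi
    simp only [Set.mem_Ico] at this
    lia
  | succ N ih =>
    by_cases hI' : I = Set.Ico a b
    · rw [Set.inter_eq_right.2 (hI' ▸ hJ)]
      exact inf_le_right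
    by_cases hJ' : J = Set.Ico a b
    · rw [Set.inter_eq_left.2 (hJ' ▸ hI)]
      exact inf_le_left
    obtain ⟨k, hk, hkI⟩ := Set.exists_of_ssubset (hI.ssubset_of_ne hI')
    obtain ⟨j, hj, hjJ⟩ := Set.exists_of_ssubset (hJ.ssubset_of_ne hJ')
    wlog hkj : k ≤ j generalizing I J k j
    · rw [inf_comm, Set.inter_comm]
      exact this hJ hI hJ' hI' j hj hjJ k hk hkI (by lia)
    simp only [Set.mem_Ico] at hk hj
    classical
    have hex : ∃ i, k ≤ i ∧ i ∉ J := ⟨j, hkj, hjJ⟩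
    obtain ⟨i, ⟨hki, hiJ⟩, hij, hmin⟩ : ∃ i, (k ≤ i ∧ i ∉ J) ∧ i ≤ j ∧
        ∀ t, k ≤ t → t < i → t ∈ J :=
      ⟨Nat.find hex, Nat.find_spec hex, Nat.find_min' hex ⟨hkj, hjJ⟩, fun t h1 h2 => by
        by_contra h
        exact Nat.find_min hex h2 ⟨h1, h⟩⟩
    rintro g ⟨hgI, hgJ⟩
    obtain ⟨x, hx, y, hy, rfl⟩ := exists_mul_of_mem_gp hc hkI hgI
    obtain ⟨x', hx', y', hy', he⟩ := exists_mul_of_mem_gp hc hiJ hgJ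
    have hd : x'⁻¹ * x = y' * y⁻¹ := by
      rw [inv_mul_eq_iff_eq_mul, ← mul_assoc, ← he, mul_inv_cancel_right]
    have hmem : x'⁻¹ * x ∈ gp r (Set.Ico (k + 1) i) := by
      refine gp_Ico_inf_le H (a := 0) (d := b) (by lia) (by lia) hb ⟨?_, ?_⟩
      · exact (gp r (Set.Ico 0 i)).mul_mem
          ((gp r (Set.Ico 0 i)).inv_mem (gp_mono (J := Set.Ico 0 i) (fun t ht => ⟨by lia, ht.2⟩) hx'))
          (gp_mono (J := Set.Ico 0 i) (fun t ht => ⟨by lia, lt_of_lt_of_le ht.2 hki⟩) hx)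
      · rw [hd]
        exact (gp r (Set.Ico (k + 1) b)).mul_mem
          (gp_mono (J := Set.Ico (k + 1) b)
            (fun t ht => ⟨Nat.succ_le_of_lt (lt_of_le_of_lt hki ht.2), (hJ ht.1).2⟩) hy')
          ((gp r (Set.Ico (k + 1) b)).inv_mem
            (gp_mono (J := Set.Ico (k + 1) b)
            (fun t ht => ⟨Nat.succ_le_of_lt ht.2, (hI ht.1).2⟩) hy))
    refine mul_mem ?_ ?_
    · refine gp_mono (Set.inter_subset_inter Set.inter_subset_left Set.inter_subset_left)
        (ih (a := a) (b := i) (I := I ∩ Set.Iio k) (J := J ∩ Set.Iio i) (by lia) ?_ ?_ (by lia)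
          ⟨hx, ?_⟩)
      · exact fun t ht => ⟨(hI ht.1).1, lt_of_lt_of_le ht.2 hki⟩
      · exact fun t ht => ⟨(hJ ht.1).1, ht.2⟩
      · have := mul_mem hx' (gp_mono (J := J ∩ Set.Iio i) (fun t ht => ?_) hmem)
        · rwa [mul_inv_cancel_left] at this
        · exact ⟨hmin t (by have := ht.1; lia) ht.2, ht.2⟩
    · refine gp_mono (Set.inter_subset_inter Set.inter_subset_left Set.inter_subset_left)
        (ih (a := k + 1) (b := b) (I := I ∩ Set.Ioi k) (J := J ∩ Set.Ioi k) (by lia) ?_ ?_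
          (by lia) ⟨hy, ?_⟩)
      · exact fun t ht => ⟨Nat.succ_le_of_lt ht.2, (hI ht.1).2⟩
      · exact fun t ht => ⟨Nat.succ_le_of_lt ht.2, (hJ ht.1).2⟩
      · have := mul_mem (inv_mem (gp_mono (J := J ∩ Set.Ioi k) (fun t ht => ?_) hmem))
          (gp_mono (J := J ∩ Set.Ioi k) (fun t ht => ?_) hy')
        · rwa [hd, mul_inv_rev, inv_inv, mul_assoc, inv_mul_cancel, mul_one] at this
        · exact ⟨hmin t (by have := ht.1; lia) ht.2, Nat.lt_of_succ_le ht.1⟩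
        · exact ⟨ht.1, lt_of_le_of_lt hki ht.2⟩

end Intervals

section Braid

variable {G : Type*} [Group G] {r : ℕ → G}

variable (r) in
/-- The product `r a * r (a + 1) * ⋯ * r (a + t - 1)`. -/
def stringProd (a : ℕ) : ℕ → G
  | 0 => 1
  | t + 1 => stringProd a t * r (a + t)

theorem stringProd_commute (hc : ∀ i j, i + 2 ≤ j → r i * r j = r j * r i) {a t i : ℕ}
    (h : a + t < i) : stringProd r a t * r i = r i * stringProd r a t := by
  induction t with
  | zero => simp [stringProd]
  | succ t ih =>
    rw [stringProd, mul_assoc, hc _ _ (by lia), ← mul_assoc, ih (by lia), mul_assoc]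

theorem stringProd_shift {n : ℕ} (hc : ∀ i j, i + 2 ≤ j → r i * r j = r j * r i)
    (hbr : ∀ i, i + 1 < n → r i * r (i + 1) * r i = r (i + 1) * r i * r (i + 1)) {a s t : ℕ}
    (h : s + 1 < t) (ht : a + t ≤ n) :
    stringProd r a t * r (a + s) = r (a + s + 1) * stringProd r a t := by
  induction t with
  | zero => lia
  | succ t ih =>
    rcases (Nat.lt_succ_iff.1 h).eq_or_lt with rfl | h
    · have h1 := hbr (a + s) (by lia)
      have h2 := stringProd_commute hc (a := a) (t := s) (i := a + s + 1) (by lia)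
      simp only [stringProd, ← add_assoc]
      calc _ = stringProd r a s * (r (a + s) * r (a + s + 1) * r (a + s)) := by
            simp only [mul_assoc]
        _ = stringProd r a s * r (a + s + 1) * (r (a + s) * r (a + s + 1)) := by
            rw [h1]
            simp only [mul_assoc]
        _ = _ := by
            rw [h2]
            simp only [mul_assoc]
    · rw [stringProd, mul_assoc, ← hc (a + s) (a + t) (by lia), ← mul_assoc, ih h (by lia),
        mul_assoc]

/-- Double cosets of the parabolic subgroup omitting an end node of a braid relation diagram. -/
theorem mem_gp_or_of_braid {n : ℕ} (hc : ∀ i j, i + 2 ≤ j → r i * r j = r j * r i)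
    (hbr : ∀ i, i + 1 < n → r i * r (i + 1) * r i = r (i + 1) * r i * r (i + 1))
    (hsq : ∀ i, r i * r i = 1) {a b : ℕ} (hb : b ≤ n) {g : G} (hg : g ∈ gp r (Set.Ico a b)) :
    g ∈ gp r (Set.Ico (a + 1) b) ∨
      ∃ x ∈ gp r (Set.Ico (a + 1) b), ∃ y ∈ gp r (Set.Ico (a + 1) b), g = x * r a * y := by
  have hstep : ∀ x i, i ∈ Set.Ico a b → (∃ h ∈ gp r (Set.Ico (a + 1) b), ∃ t, (t = 0 ∨ a + t ≤ b) ∧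
      x = h * stringProd r a t) → ∃ h ∈ gp r (Set.Ico (a + 1) b), ∃ t, (t = 0 ∨ a + t ≤ b) ∧
      x * r i = h * stringProd r a t := by
    rintro _ i ⟨hi1, hi2⟩ ⟨h, hh, t, ht, rfl⟩
    obtain ⟨s, rfl⟩ := Nat.exists_eq_add_of_le hi1
    rcases lt_trichotomy s t with hst | rfl | hst
    · rcases (Nat.succ_le_of_lt hst).eq_or_lt with rfl | hst'
      · refine ⟨h, hh, s, Or.inr hi2.le, ?_⟩
        rw [stringProd, mul_assoc, mul_assoc, hsq, mul_one]
      · refine ⟨h * r (a + s + 1), mul_mem hh (mem_gp ⟨by lia, by lia⟩), t, ht, ?_⟩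
        rw [mul_assoc, stringProd_shift hc hbr hst' (by lia), mul_assoc]
    · exact ⟨h, hh, s + 1, Or.inr hi2, by rw [stringProd, mul_assoc]⟩
    · refine ⟨h * r (a + s), mul_mem hh (mem_gp ⟨by lia, by lia⟩), t, ht, ?_⟩
      rw [mul_assoc, stringProd_commute hc (by lia), mul_assoc]
  have hsplit : ∀ t, ∀ b, a + t < b →
      ∃ y ∈ gp r (Set.Ico (a + 1) b), stringProd r a (t + 1) = r a * y := by
    intro t
    induction t with
    | zero => exact fun b _ => ⟨1, one_mem _, by simp [stringProd]⟩
    | succ t ih =>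
      intro b hb
      obtain ⟨y, hy, h⟩ := ih b (by lia)
      exact ⟨y * r (a + (t + 1)), mul_mem hy (mem_gp ⟨by lia, by lia⟩), by
        rw [stringProd, h, mul_assoc]⟩
  obtain ⟨h, hh, t, ht, rfl⟩ : ∃ h ∈ gp r (Set.Ico (a + 1) b), ∃ t, (t = 0 ∨ a + t ≤ b) ∧
      g = h * stringProd r a t := by
    refine Subgroup.closure_induction_right (p := fun g _ => ∃ h ∈ gp r (Set.Ico (a + 1) b),
      ∃ t, (t = 0 ∨ a + t ≤ b) ∧ g = h * stringProd r a t) ?_ ?_ ?_ hg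
    · exact ⟨1, one_mem _, 0, Or.inl rfl, by simp [stringProd]⟩
    · rintro x - _ ⟨i, hi, rfl⟩ h
      exact hstep x i hi h
    · rintro x - _ ⟨i, hi, rfl⟩ h
      rw [inv_eq_of_mul_eq_one_left (hsq i)]
      exact hstep x i hi h
  cases t with
  | zero => exact Or.inl (by simpa [stringProd] using hh)
  | succ t =>
    obtain ⟨y, hy, h'⟩ := hsplit t b (by lia)
    exact Or.inr ⟨h, hh, y, hy, by rw [h', mul_assoc]⟩

end Braid

section Diagram

theorem refl_commute {K V : Type*} [Field K] [AddCommGroup V] [Module K V]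
    {B : LinearMap.BilinForm K V} {u v : V} (hu : B u u = 1) (hv : B v v = 1) (huv : B u v = 0)
    (hvu : B v u = 0) : refl B u * refl B v = refl B v * refl B u := by
  refine units_ext fun x => ?_
  simp only [mul_smul, refl_smul hu, refl_smul hv, map_sub, map_smul, LinearMap.sub_apply,
    LinearMap.smul_apply, huv, hvu, smul_eq_mul]
  module

theorem refl_braid {K V : Type*} [Field K] [AddCommGroup V] [Module K V]
    {B : LinearMap.BilinForm K V} (hB : B.IsSymm) {u v : V} (hu : B u u = 1) (hv : B v v = 1)
    (h : 2 * B u v = 1 ∨ 2 * B u v = -1) :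
    refl B u * refl B v * refl B u = refl B v * refl B u * refl B v := by
  have h1 := refl_conj (refl_mem_isom hB hu) hv
  have h2 := refl_conj (refl_mem_isom hB hv) hu
  rw [refl_inv hu] at h1
  rw [refl_inv hv] at h2
  rw [← h1, ← h2, refl_smul hu, refl_smul hv, bsymm hB v u]
  rcases h with h | h
  · rw [h, ← refl_neg]
    congr 1
    module
  · rw [h]
    congr 1
    module

variable (p k l m : ℕ)

/-- The bilinear form with Gram matrix `gram p k l m`. -/
noncomputable def gramForm : LinearMap.BilinForm (ZMod p) (Fin (k + l + m + 1) → ZMod p) :=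
  Matrix.toBilin' (gram p k l m)

theorem gramForm_apply (x y : Fin (k + l + m + 1) → ZMod p) :
    gramForm p k l m x y = form p k l m x y := Matrix.toBilin'_apply _ _ _

/-- The standard basis vectors, extended by `0`. -/
def node (i : ℕ) : Fin (k + l + m + 1) → ZMod p :=
  if h : i < k + l + m + 1 then Pi.single ⟨i, h⟩ 1 else 0

variable {p k l m}

theorem node_of_lt {i : ℕ} (h : i < k + l + m + 1) : node p k l m i = Pi.single ⟨i, h⟩ 1 :=
  dif_pos h

theorem gramForm_node {i j : ℕ} (hi : i < k + l + m + 1) (hj : j < k + l + m + 1) :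
    gramForm p k l m (node p k l m i) (node p k l m j) = gram p k l m ⟨i, hi⟩ ⟨j, hj⟩ := by
  rw [node_of_lt hi, node_of_lt hj, gramForm, Matrix.toBilin'_single]

theorem gramForm_apply_node (x : Fin (k + l + m + 1) → ZMod p) {j : ℕ}
    (hj : j < k + l + m + 1) :
    gramForm p k l m x (node p k l m j) = ∑ i, x i * gram p k l m i ⟨j, hj⟩ := by
  rw [gramForm_apply, form, node_of_lt hj]
  refine Finset.sum_congr rfl fun i _ => ?_
  rw [Finset.sum_eq_single ⟨j, hj⟩]
  · simp
  · intro t _ ht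
    simp [Pi.single_eq_of_ne ht]
  · simp

theorem gramForm_isSymm : (gramForm p k l m).IsSymm := by
  have : (gram p k l m).IsSymm := by
    ext i j
    simp only [Matrix.transpose_apply, gram, eq_comm (a := j) (b := i)]
    split_ifs <;> first | rfl | lia
  refine ⟨fun x y => ?_⟩
  rw [gramForm_apply, gramForm_apply, form, form, Finset.sum_comm]
  refine Finset.sum_congr rfl fun i _ => Finset.sum_congr rfl fun j _ => ?_
  rw [this.apply]
  ring

theorem gram_self (i : Fin (k + l + m + 1)) : gram p k l m i i = 1 := if_pos rfl

theorem gram_succ {i : ℕ} (h : i + 1 < k + l + m + 1) :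
    gram p k l m ⟨i, by lia⟩ ⟨i + 1, h⟩ = if i + 1 ≤ k ∨ k + l ≤ i then -2⁻¹ else -1 := by
  simp [gram]

theorem gram_far {i j : Fin (k + l + m + 1)} (h : (i : ℕ) + 2 ≤ j ∨ (j : ℕ) + 2 ≤ i) :
    gram p k l m i j = 0 := by
  have h1 : i ≠ j := by
    rintro rfl
    lia
  rw [gram, if_neg h1, if_neg (by lia), if_neg (by lia)]

theorem gramForm_node_self {i : ℕ} (hi : i < k + l + m + 1) :
    gramForm p k l m (node p k l m i) (node p k l m i) = 1 := by
  rw [gramForm_node hi hi, gram_self]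

theorem gramForm_node_succ {i : ℕ} (hi : i + 1 < k + l + m + 1) :
    gramForm p k l m (node p k l m i) (node p k l m (i + 1)) = -1 ∨
      gramForm p k l m (node p k l m i) (node p k l m (i + 1)) = -2⁻¹ := by
  rw [gramForm_node (by lia) hi, gram_succ]
  split_ifs <;> simp

theorem gramForm_node_far {i j : ℕ} (hi : i < k + l + m + 1) (hj : j < k + l + m + 1)
    (h : i + 2 ≤ j ∨ j + 2 ≤ i) : gramForm p k l m (node p k l m i) (node p k l m j) = 0 := by
  rw [gramForm_node hi hj, gram_far h]

variable [Fact p.Prime]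

variable (p k l m) in
/-- The reflections in the nodes of the diagram. -/
noncomputable def nodeRefl (i : ℕ) : GLV p k l m := refl (gramForm p k l m) (node p k l m i)

theorem nodeRefl_of_not_lt {i : ℕ} (h : ¬ i < k + l + m + 1) : nodeRefl p k l m i = 1 := by
  rw [nodeRefl, refl, dif_neg]
  simp [node, h]

theorem nodeRefl_sq (i : ℕ) : nodeRefl p k l m i * nodeRefl p k l m i = 1 := by
  by_cases h : i < k + l + m + 1
  · exact refl_mul_self (gramForm_node_self h)
  · rw [nodeRefl_of_not_lt h, mul_one]

theorem nodeRefl_commute (i j : ℕ) (h : i + 2 ≤ j) :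
    nodeRefl p k l m i * nodeRefl p k l m j = nodeRefl p k l m j * nodeRefl p k l m i := by
  by_cases hj : j < k + l + m + 1
  · exact refl_commute (gramForm_node_self (by lia)) (gramForm_node_self hj)
      (gramForm_node_far (by lia) hj (Or.inl h)) (gramForm_node_far hj (by lia) (Or.inr h))
  · rw [nodeRefl_of_not_lt hj, mul_one, one_mul]

theorem gp_nodeRefl_apply {I : Set ℕ} {g : GLV p k l m} (hg : g ∈ gp (nodeRefl p k l m) I)
    {i : Fin (k + l + m + 1)} (hi : (i : ℕ) ∉ I) (x : Fin (k + l + m + 1) → ZMod p) :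
    (g • x) i = x i := by
  revert x
  refine Subgroup.closure_induction (p := fun g _ => ∀ x : Fin (k + l + m + 1) → ZMod p,
    (g • x) i = x i) ?_ ?_ ?_ ?_ hg
  · rintro _ ⟨j, hj, rfl⟩ x
    by_cases h : j < k + l + m + 1
    · have : i ≠ ⟨j, h⟩ := by
        rintro rfl
        exact hi hj
      rw [nodeRefl, refl_smul (gramForm_node_self h), node_of_lt h]
      simp [this]
    · rw [nodeRefl_of_not_lt h, one_smul]
  · simp
  · intro g h _ _ h1 h2 x
    rw [mul_smul, h1, h2]
  · intro g _ h x
    rw [← h (g⁻¹ • x), smul_inv_smul]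

theorem gp_nodeRefl_le_isom {I : Set ℕ} :
    gp (nodeRefl p k l m) I ≤ isom (gramForm p k l m) := gp_le fun i _ => by
  by_cases h : i < k + l + m + 1
  · exact refl_mem_isom gramForm_isSymm (gramForm_node_self h)
  · rw [nodeRefl_of_not_lt h]
    exact one_mem _

theorem nodeRefl_braid_of_eq_three (hp : p = 3) (i : ℕ) (hi : i + 1 < k + l + m + 1) :
    nodeRefl p k l m i * nodeRefl p k l m (i + 1) * nodeRefl p k l m i =
      nodeRefl p k l m (i + 1) * nodeRefl p k l m i * nodeRefl p k l m (i + 1) := by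
  refine refl_braid gramForm_isSymm (gramForm_node_self (by lia)) (gramForm_node_self hi) ?_
  have h2 : (2 : ZMod p) ≠ 0 := two_ne_zero_zmod (by lia)
  have h3 : (3 : ZMod p) = 0 := by
    subst hp
    rfl
  rcases gramForm_node_succ hi with h | h
  · exact Or.inl (by rw [h]; linear_combination -h3)
  · exact Or.inr (by rw [h]; field_simp)

theorem gp_Ico_inf_le_of_eq_three (hp : p = 3) {a b : ℕ} (hab : a < b) (hb : b < k + l + m + 1) :
    gp (nodeRefl p k l m) (Set.Ico a b) ⊓ gp (nodeRefl p k l m) (Set.Ico (a + 1) (b + 1)) ≤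
      gp (nodeRefl p k l m) (Set.Ico (a + 1) b) := by
  rintro g ⟨h1, h2⟩
  have ha : a < k + l + m + 1 := by lia
  rcases mem_gp_or_of_braid (n := k + l + m + 1) nodeRefl_commute
    (nodeRefl_braid_of_eq_three hp) nodeRefl_sq hb.le h1 with h | ⟨x, hx, y, hy, rfl⟩
  · exact h
  exfalso
  have hz : ∀ {t : ℕ} {g : GLV p k l m}, g ∈ gp (nodeRefl p k l m) (Set.Ico (a + 1) t) →
      ∀ v : Fin (k + l + m + 1) → ZMod p, (g • v) ⟨a, ha⟩ = v ⟨a, ha⟩ := fun hg v => gp_nodeRefl_apply hg (by simp) v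
  have h3 := hz h2 (y⁻¹ • node p k l m a)
  rw [mul_smul, mul_smul, smul_inv_smul, hz hx, hz (inv_mem hy), nodeRefl,
    refl_smul (gramForm_node_self ha), gramForm_node_self ha, node_of_lt ha] at h3
  simp only [mul_one, Pi.sub_apply, Pi.smul_apply, Pi.single_eq_same, smul_eq_mul] at h3
  exact two_ne_zero_zmod (p := p) (by lia) (by linear_combination -h3)

end Diagram

section Hyperbolic

variable {p k l m : ℕ} [Fact p.Prime]

theorem isChain_node {a b : ℕ} (ha : k ≤ a) (hb : b ≤ k + l + 1) :
    IsChain (gramForm p k l m) (b - a) fun i => node p k l m (a + i) where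
  norm i hi := gramForm_node_self (by lia)
  adj i hi := by
    rw [gramForm_node (by lia) (by lia)]
    exact (gram_succ (i := a + i) (by lia)).trans (if_neg (by lia))
  adj' i hi := by
    rw [bsymm gramForm_isSymm, gramForm_node (by lia) (by lia)]
    exact (gram_succ (i := a + i) (by lia)).trans (if_neg (by lia))
  far i j hij hj := gramForm_node_far (by lia) (by lia) (Or.inl (by lia))
  far' i j hij hj := gramForm_node_far (by lia) (by lia) (Or.inr (by lia))

theorem mem_chainSpan_node {a b : ℕ} {z : Fin (k + l + m + 1) → ZMod p} :
    z ∈ chainSpan (K := ZMod p) (fun i => node p k l m (a + i)) (b - a) ↔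
      ∀ i : Fin (k + l + m + 1), (i : ℕ) ∉ Set.Ico a b → z i = 0 := by
  constructor
  · intro hz i hi
    refine Submodule.span_induction (p := fun (z : Fin (k + l + m + 1) → ZMod p) _ => z i = 0)
      ?_ ?_ ?_ ?_ hz
    · rintro _ ⟨t, ht, rfl⟩
      have ht' : t < b - a := ht
      dsimp only [node]
      split_ifs with h
      · refine Pi.single_eq_of_ne ?_ _
        rintro rfl
        exact hi ⟨by simp, by simp; lia⟩
      · rfl
    · rfl
    · intro x y _ _ hx hy
      rw [Pi.add_apply, hx, hy, add_zero]
    · intro c x _ hx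
      rw [Pi.smul_apply, hx, smul_zero]
  · intro h
    have hz : z = ∑ i, z i • (Pi.single i 1 : Fin (k + l + m + 1) → ZMod p) := by
      ext j
      simp [Finset.sum_apply, Pi.single_apply]
    rw [hz]
    refine Submodule.sum_mem _ fun i _ => ?_
    by_cases hi : (i : ℕ) ∈ Set.Ico a b
    · refine Submodule.smul_mem _ _ (Submodule.subset_span ⟨i - a, ?_, ?_⟩)
      · have := hi.1
        have := hi.2
        simp only [Set.mem_Iio]
        lia
      · have : a + ((i : ℕ) - a) = i := by
          have := hi.1
          lia
        simp only [this]
        exact node_of_lt i.2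
    · rw [h i hi, zero_smul]
      exact zero_mem _

/-- The node before an interval detects the radical of the span of the interval. -/
theorem radicalDetects_node (hp : p ≠ 2) {a b : ℕ} :
    RadicalDetects (gramForm p k l m)
      (chainSpan (fun i => node p k l m (a + 1 + i)) (b - (a + 1))) (node p k l m a) := by
  intro z hz hrad ha
  have hz' := mem_chainSpan_node.1 hz
  have horth : ∀ j, a ≤ j → j < b → gramForm p k l m z (node p k l m j) = 0 := by
    intro j h1 h2
    rcases h1.eq_or_lt with rfl | h1
    · exact ha
    · obtain ⟨t, rfl⟩ := Nat.exists_eq_add_of_le (Nat.succ_le_of_lt h1)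
      exact hrad _ (mem_chainSpan (c := fun i => node p k l m (a + 1 + i)) (i := t) (by lia))
  have key : ∀ j (hj : j < k + l + m + 1), z ⟨j, hj⟩ = 0 := by
    intro j
    induction j using Nat.strong_induction_on with
    | _ j ih =>
    intro hj
    by_cases hmem : j ∈ Set.Ico (a + 1) b
    swap
    · exact hz' _ hmem
    obtain ⟨h1, h2⟩ := hmem
    obtain ⟨i, rfl⟩ : ∃ i, j = i + 1 := ⟨j - 1, by lia⟩
    have h := horth i (by lia) (by lia)
    rw [gramForm_apply_node z (show i < k + l + m + 1 by lia),
      Finset.sum_eq_single ⟨i + 1, hj⟩] at h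
    · refine (mul_eq_zero.1 h).resolve_right ?_
      rw [← gramForm_node hj (by lia), bsymm gramForm_isSymm]
      rcases gramForm_node_succ (p := p) hj with h | h <;> rw [h]
      · simp
      · simpa using two_ne_zero_zmod hp
    · rintro ⟨t, ht⟩ - hne
      by_cases hti : t < i + 1
      · rw [ih t hti, zero_mul]
      · have : t ≠ i + 1 := fun h => hne (Fin.ext h)
        rw [gram_far (Or.inr (by simp only; lia)), mul_zero]
    · simp
  exact funext fun i => key i i.2

theorem sphereSign_node (hp : p ≠ 2) {i : ℕ} (hi : i < k + l + m + 1) :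
    sphereSign (gramForm p k l m)
        ⟨refl _ (node p k l m i), refl_mem_isom gramForm_isSymm (gramForm_node_self hi)⟩ =
      sphereSign (gramForm p k l m) ⟨refl _ (node p k l m 0),
        refl_mem_isom gramForm_isSymm (gramForm_node_self (Nat.succ_pos _))⟩ := by
  induction i with
  | zero => rfl
  | succ i ih =>
    rw [← ih (by lia)]
    exact (sphereSign_refl_eq_of_adj hp gramForm_isSymm (gramForm_node_self (by lia))
      (gramForm_node_self hi) (gramForm_node_succ hi)).symm

theorem hypUnit_not_mem_gp (hp : p ≠ 2) {e f : Fin (k + l + m + 1) → ZMod p}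
    (hef : HypPair (gramForm p k l m) e f) {lam : ZMod p} (hsq : ¬ IsSquare lam) {I : Set ℕ}
    (hI : I ⊆ Set.Iio (k + l + m + 1)) :
    hypUnit (gramForm p k l m) e f lam ∉ gp (nodeRefl p k l m) I := by
  have h : gp (nodeRefl p k l m) I =
      Subgroup.closure (refl (gramForm p k l m) '' (node p k l m '' I)) := by
    rw [Set.image_image]
    rfl
  rw [h]
  refine hypUnit_not_mem_closure hp gramForm_isSymm (s := sphereSign (gramForm p k l m)
    ⟨refl _ (node p k l m 0),
        refl_mem_isom gramForm_isSymm (gramForm_node_self (Nat.succ_pos _))⟩) ?_ hef hsq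
  rintro _ ⟨i, hi, rfl⟩
  exact ⟨gramForm_node_self (hI hi), sphereSign_node hp (hI hi)⟩

theorem gp_Ico_inf_le_of_ne_three (hp : p ≠ 2) (hp3 : p ≠ 3) {a b : ℕ} (ha : k ≤ a + 1)
    (hb : b ≤ k + l + 1) (hb' : b < k + l + m + 1) :
    gp (nodeRefl p k l m) (Set.Ico a b) ⊓ gp (nodeRefl p k l m) (Set.Ico (a + 1) (b + 1)) ≤
      gp (nodeRefl p k l m) (Set.Ico (a + 1) b) := by
  rintro g ⟨h1, h2⟩
  have hgr : chainGroup (gramForm p k l m) (fun i => node p k l m (a + 1 + i)) (b - (a + 1)) ≤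
      gp (nodeRefl p k l m) (Set.Ico (a + 1) b) :=
    chainGroup_le fun i hi => mem_gp (r := nodeRefl p k l m) (i := a + 1 + i) ⟨by lia, by lia⟩
  have hM : ∀ x : Fin (k + l + m + 1) → ZMod p, g • x - x ∈
      chainSpan (K := ZMod p) (fun i => node p k l m (a + 1 + i)) (b - (a + 1)) := by
    intro x
    refine mem_chainSpan_node.2 fun i hi => ?_
    rw [Pi.sub_apply, sub_eq_zero]
    by_cases hia : (i : ℕ) ∈ Set.Ico a b
    · refine gp_nodeRefl_apply h2 ?_ x
      simp only [Set.mem_Ico] at *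
      lia
    · exact gp_nodeRefl_apply h1 hia x
  rcases (isChain_node ha hb).mem_or_exists hp hp3 gramForm_isSymm
    (radicalDetects_node hp) (gp_nodeRefl_le_isom h1) hM with
    h | ⟨ν, hν, lam, e, f, hsq, hef, h⟩
  · exact hgr h
  · refine absurd ?_ (hypUnit_not_mem_gp hp hef hsq (I := Set.Ico a b) ?_)
    · rw [← h]
      exact mul_mem (gp_mono (Set.Ico_subset_Ico_left (by lia)) (hgr hν)) h1
    · exact fun i hi => lt_trans hi.2 hb'

end Hyperbolic

/-- `[3, ∞^l, 3]ᵖ` is a string C-group, except possibly when `p = 7` and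
`l ≥ 4` with `l ≡ 1 (mod 3)`. -/
theorem statement10 (p l : ℕ) (hp : p.Prime) (hodd : p ≠ 2) (hl : 1 ≤ l)
    (hexc : ¬ (p = 7 ∧ 4 ≤ l ∧ l % 3 = 1))
    (r : Fin (1 + l + 1 + 1) → GLV p 1 l 1) (hr : ReflHyp p 1 l 1 r) :
    IsStringC p 1 l 1 r := by
  have := Fact.mk hp
  have hr' : ∀ I : Set (Fin (1 + l + 1 + 1)), Subgroup.closure (r '' I) =
      gp (nodeRefl p 1 l 1) (Fin.val '' I) := by
    intro I
    rw [gp, Set.image_image]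
    congr 1
    refine Set.image_congr fun i _ => units_ext fun x => ?_
    rw [nodeRefl, refl_smul (gramForm_node_self i.2), gramForm_apply, node_of_lt i.2]
    exact hr i x
  intro I J
  rw [hr', hr', hr', Set.image_inter Fin.val_injective]
  refine le_antisymm ?_ (le_inf (gp_mono Set.inter_subset_left) (gp_mono Set.inter_subset_right))
  have hsub : ∀ I : Set (Fin (1 + l + 1 + 1)), Fin.val '' I ⊆ Set.Ico 0 (1 + l + 1 + 1) := by
    rintro I _ ⟨i, -, rfl⟩
    exact ⟨Nat.zero_le _, i.2⟩
  refine gp_inf_le nodeRefl_commute (fun a b hab hb => ?_) le_rfl (hsub I) (hsub J)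
  by_cases hp3 : p = 3
  · exact gp_Ico_inf_le_of_eq_three hp3 hab hb
  · exact gp_Ico_inf_le_of_ne_three hodd hp3 (by lia) (by lia) hb

end Statement10
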